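/- arXiv:2110.15406 — 2 statements merged into one kernel-verified Lean document; each statement's English description precedes it below -/
import Mathlib

section
/- Let K(x,x') = φ(x)ᵀφ(x') for a feature map φ : ℝᵈ → ℝ^q with q < ∞. Fix any samples (X, Y, Z) with n units, let Φ = (φ(X_1),…,φ(X_n))ᵀ, let B be the group-blocked design matrix, let P₀ and P₁ be the orthogonal projections onto the column spaces of Φ and B with ranks p₀ and p₁, and assume p₀ < p₁ < n and Yᵀ(I_n − P₀)Y > 0. Then the permutation distribution of the F statistic under the continuous partial permutation test with kernel K and permutation size b = n − p₀ — that is, the law of F(X, Γ W*, Z) where W* is the continuous partial permutation of W = ΓᵀY — is exactly the F distribution with degrees of freedom (p₁ − p₀, n − p₁); consequently the continuous partial permutation p-value with test statistic F equals 1 − F_{p₁−p₀, n−p₁}(F(X,Y,Z)), where F_{a,b} is the distribution function of the F distribution with degrees of freedom (a,b). -/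
open MeasureTheory ProbabilityTheory Filter

noncomputable section

namespace PPT

/-- The law of `k` i.i.d. standard Gaussian random variables. -/
def stdGaussianPi (k : ℕ) : Measure (Fin k → ℝ) :=
  Measure.pi fun _ => gaussianReal 0 1

/-- The law of `n` i.i.d. centered Gaussian noises with standard deviation `σ`. -/
def noiseLaw (n : ℕ) (σ : ℝ) : Measure (Fin n → ℝ) :=
  Measure.pi fun _ => gaussianReal 0 ((σ ^ 2).toNNReal)

/-- Matrix (given as a function) times vector. -/
def mulVecF {n m : ℕ} (A : Fin n → Fin m → ℝ) (v : Fin m → ℝ) : Fin n → ℝ :=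
  fun i => ∑ j, A i j * v j

/-- Transposed matrix times vector, `Aᵀ v`. -/
def tmulVecF {n : ℕ} (A : Fin n → Fin n → ℝ) (v : Fin n → ℝ) : Fin n → ℝ :=
  fun i => ∑ j, A j i * v j

/-- Matrix product of matrices given as functions. -/
def mulF {n : ℕ} (A B : Fin n → Fin n → ℝ) : Fin n → Fin n → ℝ :=
  fun i j => ∑ k, A i k * B k j

/-- The identity matrix as a function. -/
def idF (n : ℕ) : Fin n → Fin n → ℝ :=
  fun i j => if i = j then 1 else 0

/-- Quadratic form `vᵀ A v`. -/
def quadForm {n : ℕ} (A : Fin n → Fin n → ℝ) (v : Fin n → ℝ) : ℝ :=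
  ∑ i, ∑ j, v i * A i j * v j

/-- `A` is an orthogonal matrix: `A Aᵀ = I`. -/
def IsOrthogonalF {n : ℕ} (A : Fin n → Fin n → ℝ) : Prop :=
  ∀ i j, (∑ k, A i k * A j k) = if i = j then (1 : ℝ) else 0

/-- `(Γ, c)` is an eigendecomposition `Kmat = Γ diag(c) Γᵀ` of `Kmat`, with `Γ` orthogonal and
the eigenvalues `c` nonnegative and in nonincreasing order. -/
def IsEigenDecomp {n : ℕ} (Kmat Γ : Fin n → Fin n → ℝ) (c : Fin n → ℝ) : Prop :=
  IsOrthogonalF Γ ∧ (∀ i j, Kmat i j = ∑ k, Γ i k * c k * Γ j k) ∧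
    (∀ i j : Fin n, i ≤ j → c j ≤ c i) ∧ (∀ i, 0 ≤ c i)

/-- A symmetric positive semidefinite kernel on `ℝᵈ`. -/
def IsPSDKernel {d : ℕ} (K : (Fin d → ℝ) → (Fin d → ℝ) → ℝ) : Prop :=
  (∀ x y, K x y = K y x) ∧
    ∀ (m : ℕ) (v : Fin m → (Fin d → ℝ)) (a : Fin m → ℝ),
      0 ≤ ∑ i, ∑ j, a i * a j * K (v i) (v j)

/-- The set `M(n,b)` of permutations of `{0, …, n-1}` keeping the first `n - b` elements fixed. -/
def permSet (n b : ℕ) : Finset (Equiv.Perm (Fin n)) :=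
  Finset.univ.filter fun ψ => ∀ i : Fin n, (i : ℕ) < n - b → ψ i = i

/-- The discrete partial permutation p-value, with covariates `X`, group labels `Z`,
test statistic `T`, eigenvector matrix `Γ`, permutation size `b` and responses `Y`. -/
def pDisc {n d H : ℕ} (X : Fin n → Fin d → ℝ) (Z : Fin n → Fin H)
    (T : (Fin n → Fin d → ℝ) → (Fin n → ℝ) → (Fin n → Fin H) → ℝ)
    (Γ : Fin n → Fin n → ℝ) (b : ℕ) (Y : Fin n → ℝ) : ℝ :=
  ((permSet n b).card : ℝ)⁻¹ *
    ∑ ψ ∈ permSet n b,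
      if T X Y Z ≤ T X (mulVecF Γ ((tmulVecF Γ Y) ∘ ψ)) Z then 1 else 0

/-- Squared norm of the last `b` coordinates of a vector in `ℝⁿ`. -/
def tailNormSq {n : ℕ} (b : ℕ) (w : Fin n → ℝ) : ℝ :=
  ∑ i ∈ Finset.univ.filter (fun i : Fin n => n - b ≤ (i : ℕ)), w i ^ 2

/-- The continuous partial permutation of `w` driven by `g`: it agrees with `w` on the first
`n - b` coordinates, and its last `b` coordinates are those of `g` rescaled to lie on the sphere
of radius `(Σ_{i ≥ n-b} w i ^ 2)^{1/2}`.  When `g` is standard Gaussian, the last `b` coordinates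
are uniformly distributed on that sphere. -/
def wStar {n : ℕ} (b : ℕ) (w g : Fin n → ℝ) : Fin n → ℝ := fun i =>
  if (i : ℕ) < n - b then w i
  else Real.sqrt (tailNormSq b w) * g i / Real.sqrt (tailNormSq b g)

/-- The continuous partial permutation p-value. -/
def pCont {n d H : ℕ} (X : Fin n → Fin d → ℝ) (Z : Fin n → Fin H)
    (T : (Fin n → Fin d → ℝ) → (Fin n → ℝ) → (Fin n → Fin H) → ℝ)
    (Γ : Fin n → Fin n → ℝ) (b : ℕ) (Y : Fin n → ℝ) : ℝ :=
  (stdGaussianPi n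
    {g | T X Y Z ≤ T X (mulVecF Γ (wStar b (tmulVecF Γ Y) g)) Z}).toReal

/-- The chi-squared distribution with `k` degrees of freedom, realized as the law of the sum of
squares of `k` independent standard Gaussians. -/
def chiSq (k : ℕ) : Measure ℝ :=
  Measure.map (fun g : Fin k → ℝ => ∑ i, g i ^ 2) (stdGaussianPi k)

/-- The quantile function of the chi-squared distribution with `k` degrees of freedom. -/
def chiSqQuantile (k : ℕ) (p : ℝ) : ℝ :=
  sInf {x : ℝ | ENNReal.ofReal p ≤ chiSq k (Set.Iic x)}

end PPT

namespace PPT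

/-- The span of the columns of a matrix given as a function. -/
def colSpace {n : ℕ} {m : Type*} (A : Fin n → m → ℝ) : Submodule ℝ (Fin n → ℝ) :=
  Submodule.span ℝ (Set.range fun j => fun i => A i j)

/-- `Pm` is the orthogonal projection onto the column space of `A`:
it is symmetric, idempotent, and its column space equals that of `A`. -/
def IsOrthProjOnto {n : ℕ} {m : Type*} (Pm : Fin n → Fin n → ℝ) (A : Fin n → m → ℝ) : Prop :=
  (∀ i j, Pm i j = Pm j i) ∧ mulF Pm Pm = Pm ∧ colSpace Pm = colSpace A

/-- The F distribution with degrees of freedom `(a, b)`, realized as the law of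
`(U₁/a)/(U₂/b)` for independent chi-squared variables `U₁ ~ χ²(a)` and `U₂ ~ χ²(b)`. -/
def Fdist (a b : ℕ) : Measure ℝ :=
  Measure.map
    (fun gp : (Fin a → ℝ) × (Fin b → ℝ) =>
      ((∑ i, gp.1 i ^ 2) / a) / ((∑ i, gp.2 i ^ 2) / b))
    ((stdGaussianPi a).prod (stdGaussianPi b))

end PPT

namespace PPT

theorem mulVecF_eq {n m : ℕ} (A : Fin n → Fin m → ℝ) (v : Fin m → ℝ) :
    mulVecF A v = Matrix.mulVec (Matrix.of A) v := rfl

theorem quadForm_eq {n : ℕ} (A : Fin n → Fin n → ℝ) (v : Fin n → ℝ) :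
    quadForm A v = ∑ i, v i * mulVecF A v i := by
  simp only [quadForm, mulVecF, Finset.mul_sum, mul_assoc]

theorem proj_fix {n : ℕ} {m : Type*} {P : Fin n → Fin n → ℝ} {A : Fin n → m → ℝ}
    (h : IsOrthProjOnto P A) {v : Fin n → ℝ} (hv : v ∈ colSpace A) : mulVecF P v = v := by
  obtain ⟨hs, hi, hc⟩ := h
  rw [← hc] at hv
  have : colSpace P ≤ LinearMap.ker (Matrix.mulVecLin (Matrix.of P) - LinearMap.id) := by
    refine Submodule.span_le.2 ?_
    rintro _ ⟨j, rfl⟩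
    simp only [SetLike.mem_coe, LinearMap.mem_ker, LinearMap.sub_apply, sub_eq_zero]
    funext i
    exact congrFun (congrFun hi i) j
  have h2 := this hv
  simp only [LinearMap.mem_ker, LinearMap.sub_apply, sub_eq_zero] at h2
  exact h2

theorem ortho_col {n : ℕ} {m : Type*} {A : Fin n → m → ℝ} {v : Fin n → ℝ}
    (hv : ∀ j, ∑ i, A i j * v i = 0) {u : Fin n → ℝ} (hu : u ∈ colSpace A) :
    ∑ i, u i * v i = 0 := by
  induction hu using Submodule.span_induction with
  | mem x hx => obtain ⟨j, rfl⟩ := hx; exact hv j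
  | zero => simp
  | add x y _ _ hx hy => simp [add_mul, Finset.sum_add_distrib, hx, hy]
  | smul a x _ hx => simp [mul_assoc, ← Finset.mul_sum, hx]

theorem proj_kill {n : ℕ} {m : Type*} {P : Fin n → Fin n → ℝ} {A : Fin n → m → ℝ}
    (h : IsOrthProjOnto P A) {v : Fin n → ℝ} (hv : ∀ u ∈ colSpace A, ∑ i, u i * v i = 0) :
    mulVecF P v = 0 := by
  obtain ⟨hs, hi, hc⟩ := h
  funext i
  have : (fun k => P k i) ∈ colSpace A := by
    rw [← hc]; exact Submodule.subset_span ⟨i, rfl⟩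
  have := hv _ this
  simp only [mulVecF, Pi.zero_apply]
  rw [← this]
  exact Finset.sum_congr rfl fun j _ => by rw [hs]

theorem inner_lp {n : ℕ} (x y : EuclideanSpace ℝ (Fin n)) :
    inner ℝ x y = ∑ i, x i * y i := by
  simp [PiLp.inner_apply, mul_comm]

theorem mulVecF_sum {n : ℕ} {ι : Type*} [Fintype ι] (Q : Fin n → Fin n → ℝ)
    (b : ι → EuclideanSpace ℝ (Fin n)) (x : ι → ℝ) :
    mulVecF Q (∑ k, x k • b k).ofLp = ∑ k, x k • mulVecF Q (b k).ofLp := by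
  simp only [mulVecF_eq, WithLp.ofLp_sum, WithLp.ofLp_smul]
  rw [Matrix.mulVec_sum]
  simp [Matrix.mulVec_smul]

theorem quad_of_eig {n : ℕ} {ι : Type*} [Fintype ι]
    (b : OrthonormalBasis ι ℝ (EuclideanSpace ℝ (Fin n))) (Q : Fin n → Fin n → ℝ) (τ : ι → ℝ)
    (h : ∀ k, mulVecF Q (b k).ofLp = τ k • (b k).ofLp) (x : ι → ℝ) :
    quadForm Q (∑ k, x k • b k).ofLp = ∑ k, τ k * x k ^ 2 := by
  rw [quadForm_eq, mulVecF_sum]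
  have : ∑ k, x k • mulVecF Q (b k).ofLp = (∑ k, (τ k * x k) • b k).ofLp := by
    simp only [h, WithLp.ofLp_sum, WithLp.ofLp_smul, smul_smul, mul_comm]
  rw [this, ← inner_lp]
  classical
  rw [b.orthonormal.inner_sum]
  refine Finset.sum_congr rfl fun k _ => ?_
  simp; ring

theorem trace_of_eig {n : ℕ} {ι : Type*} [Fintype ι]
    (b : OrthonormalBasis ι ℝ (EuclideanSpace ℝ (Fin n))) (Q : Fin n → Fin n → ℝ) (τ : ι → ℝ)
    (h : ∀ k, mulVecF Q (b k).ofLp = τ k • (b k).ofLp) :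
    LinearMap.trace ℝ _ (Matrix.toEuclideanLin (Matrix.of Q)) = ∑ k, τ k := by
  rw [LinearMap.trace_eq_sum_inner _ b]
  refine Finset.sum_congr rfl fun k _ => ?_
  have : Matrix.toEuclideanLin (Matrix.of Q) (b k) = τ k • b k := by
    apply WithLp.ofLp_injective
    exact h k
  rw [this, inner_smul_right]
  simp

theorem exists_basis {E : Type*} [NormedAddCommGroup E] [InnerProductSpace ℝ E]
    [FiniteDimensional ℝ E] (U0 U1 : Submodule ℝ E) (hU : U0 ≤ U1) (a c p0 : ℕ)
    (h0 : Module.finrank ℝ U0 = p0) (h1 : Module.finrank ℝ U1 = p0 + a)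
    (hE : Module.finrank ℝ E = p0 + a + c) :
    ∃ b : OrthonormalBasis ((Fin a ⊕ Fin c) ⊕ Fin p0) ℝ E,
      (∀ i, b (.inl (.inl i)) ∈ U1 ∧ b (.inl (.inl i)) ∈ U0ᗮ) ∧
      (∀ i, b (.inl (.inr i)) ∈ U1ᗮ) ∧ ∀ i, b (.inr i) ∈ U0 := by
  have hA : Module.finrank ℝ (U0ᗮ ⊓ U1 : Submodule ℝ E) = a :=
    Submodule.finrank_add_inf_finrank_orthogonal' hU (by omega)
  have hC : Module.finrank ℝ (U1ᗮ : Submodule ℝ E) = c :=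
    Submodule.finrank_add_finrank_orthogonal' (by omega)
  let bA := (stdOrthonormalBasis ℝ (U0ᗮ ⊓ U1 : Submodule ℝ E)).reindex (finCongr hA)
  let bC := (stdOrthonormalBasis ℝ (U1ᗮ : Submodule ℝ E)).reindex (finCongr hC)
  let b0 := (stdOrthonormalBasis ℝ U0).reindex (finCongr h0)
  let v : (Fin a ⊕ Fin c) ⊕ Fin p0 → E :=
    Sum.elim (Sum.elim (fun i => (bA i : E)) (fun i => (bC i : E))) (fun i => (b0 i : E))
  have oA : ∀ i j, inner ℝ (bA i : E) (bA j : E) = if i = j then (1:ℝ) else 0 := fun i j => by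
    rw [← Submodule.coe_inner]; exact bA.inner_eq_ite i j
  have oC : ∀ i j, inner ℝ (bC i : E) (bC j : E) = if i = j then (1:ℝ) else 0 := fun i j => by
    rw [← Submodule.coe_inner]; exact bC.inner_eq_ite i j
  have o0 : ∀ i j, inner ℝ (b0 i : E) (b0 j : E) = if i = j then (1:ℝ) else 0 := fun i j => by
    rw [← Submodule.coe_inner]; exact b0.inner_eq_ite i j
  have oAC : ∀ i j, inner ℝ (bA i : E) (bC j : E) = 0 := fun i j =>
    Submodule.inner_right_of_mem_orthogonal (bA i).2.2 (bC j).2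
  have o0C : ∀ i j, inner ℝ (b0 i : E) (bC j : E) = 0 := fun i j =>
    Submodule.inner_right_of_mem_orthogonal (hU (b0 i).2) (bC j).2
  have o0A : ∀ i j, inner ℝ (b0 i : E) (bA j : E) = 0 := fun i j =>
    Submodule.inner_right_of_mem_orthogonal (b0 i).2 (bA j).2.1
  have hv : Orthonormal ℝ v := by
    rw [orthonormal_iff_ite]
    rintro ((i | i) | i) ((j | j) | j)
    · simp [v, oA]
    · simp [v, oAC]
    · simp [v]; rw [real_inner_comm]; exact o0A _ _
    · simp [v]; rw [real_inner_comm]; exact oAC _ _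
    · simp [v, oC]
    · simp [v]; rw [real_inner_comm]; exact o0C _ _
    · simp [v, o0A]
    · simp [v, o0C]
    · simp [v, o0]
  obtain ⟨b, hb⟩ := Orthonormal.exists_orthonormalBasis_extension_of_card_eq (𝕜 := ℝ) (E := E)
    (ι := (Fin a ⊕ Fin c) ⊕ Fin p0) (by simp; omega) (v := v) (s := Set.univ)
    (hv.comp _ Subtype.val_injective)
  refine ⟨b, fun i => ?_, fun i => ?_, fun i => ?_⟩
  · rw [hb _ trivial]; exact ⟨(bA i).2.2, (bA i).2.1⟩
  · rw [hb _ trivial]; exact (bC i).2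
  · rw [hb _ trivial]; exact (b0 i).2

end PPT
namespace PPT

instance (k : ℕ) : IsProbabilityMeasure (stdGaussianPi k) := by
  unfold stdGaussianPi; infer_instance

theorem sphere_null (a : ℕ) (ha : 0 < a) (r : ℝ) :
    stdGaussianPi a {g | ∑ i, g i ^ 2 = r} = 0 := by
  obtain ⟨k, rfl⟩ : ∃ k, a = k + 1 := ⟨a - 1, by omega⟩
  have hmp := measurePreserving_piFinSuccAbove (fun _ : Fin (k+1) => gaussianReal 0 1) 0
  let S : Set (ℝ × (Fin k → ℝ)) := {p | p.1 ^ 2 + ∑ i, p.2 i ^ 2 = r}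
  have hS : MeasurableSet S := measurableSet_eq_fun (by fun_prop) (by fun_prop)
  have : {g : Fin (k+1) → ℝ | ∑ i, g i ^ 2 = r} =
      (MeasurableEquiv.piFinSuccAbove (fun _ => ℝ) 0) ⁻¹' S := by
    ext g
    simp [S, Fin.sum_univ_succ, MeasurableEquiv.piFinSuccAbove, Fin.tail]
  unfold stdGaussianPi
  rw [this, hmp.measure_preimage hS.nullMeasurableSet, Measure.prod_apply_symm hS]
  refine (lintegral_congr fun y => ?_).trans lintegral_zero
  have : NullSingletonClass (gaussianReal 0 1) := nullSingletonClass_gaussianReal one_ne_zero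
  refine Set.Finite.measure_zero ?_ _
  refine Set.Finite.subset
    (Set.toFinite {Real.sqrt (r - ∑ i, y i ^ 2), - Real.sqrt (r - ∑ i, y i ^ 2)}) ?_
  intro x hx
  have hx' : x ^ 2 + ∑ i, y i ^ 2 = r := hx
  have h2 : x ^ 2 = r - ∑ i, y i ^ 2 := by linarith
  have h3 : x ^ 2 = Real.sqrt (r - ∑ i, y i ^ 2) ^ 2 := by
    rw [← h2, Real.sq_sqrt (sq_nonneg x)]
  exact sq_eq_sq_iff_eq_or_eq_neg.1 h3

theorem Fdist_atom (a b : ℕ) (ha : 0 < a) (hb : 0 < b) (t : ℝ) : Fdist a b {t} = 0 := by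
  unfold Fdist
  rw [Measure.map_apply (by fun_prop) (measurableSet_singleton t)]
  have ha' : (a : ℝ) ≠ 0 := by positivity
  have hb' : (b : ℝ) ≠ 0 := by positivity
  have hm : MeasurableSet ((fun gp : (Fin a → ℝ) × (Fin b → ℝ) =>
      ((∑ i, gp.1 i ^ 2) / a) / ((∑ i, gp.2 i ^ 2) / b)) ⁻¹' {t}) :=
    (by fun_prop : Measurable (fun gp : (Fin a → ℝ) × (Fin b → ℝ) =>
      ((∑ i, gp.1 i ^ 2) / a) / ((∑ i, gp.2 i ^ 2) / b))) (measurableSet_singleton t)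
  rw [Measure.prod_apply_symm hm, lintegral_eq_zero_iff (measurable_measure_prodMk_right hm)]
  have h0 : ∀ᵐ y ∂(stdGaussianPi b), ∑ i, y i ^ 2 ≠ 0 := by
    rw [ae_iff]
    simpa using sphere_null b hb 0
  filter_upwards [h0] with y hy
  refine measure_mono_null ?_ (sphere_null a ha (t * ((∑ i, y i ^ 2) / b) * a))
  intro x hx
  have hx' : ((∑ i, x i ^ 2) / a) / ((∑ i, y i ^ 2) / b) = t := hx
  change ∑ i, x i ^ 2 = _
  rw [← hx']
  field_simp

theorem pval_law (μ : Measure ℝ) [IsProbabilityMeasure μ] (t : ℝ) (h : μ {t} = 0) :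
    (μ (Set.Ici t)).toReal = 1 - (μ (Set.Iic t)).toReal := by
  have h1 : μ (Set.Ici t) = μ (Set.Ioi t) := by
    refine le_antisymm ?_ (measure_mono Set.Ioi_subset_Ici_self)
    rw [← Set.Ioi_insert, Set.insert_eq]
    refine (measure_union_le _ _).trans ?_
    rw [h, zero_add]
  rw [h1, ← Set.compl_Iic]
  exact probReal_compl_eq_one_sub measurableSet_Iic

theorem pi_sum_law (a c p : ℕ) (f : (Fin a → ℝ) × (Fin c → ℝ) → ℝ) (hf : Measurable f) :
    Measure.map (fun x : (Fin a ⊕ Fin c) ⊕ Fin p → ℝ =>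
      f (fun i => x (.inl (.inl i)), fun i => x (.inl (.inr i))))
      (Measure.pi fun _ => gaussianReal 0 1) =
    Measure.map f ((stdGaussianPi a).prod (stdGaussianPi c)) := by
  have m1 := measurePreserving_sumPiEquivProdPi
    (fun _ : (Fin a ⊕ Fin c) ⊕ Fin p => gaussianReal 0 1)
  have m2 := measurePreserving_sumPiEquivProdPi
    (fun _ : Fin a ⊕ Fin c => gaussianReal 0 1)
  have m3 := (m2.comp measurePreserving_fst).comp m1
  unfold stdGaussianPi
  rw [← m3.map_eq, Measure.map_map hf m3.measurable]
  rfl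

end PPT
namespace PPT

theorem exists_gamma {n : ℕ} {Γ : Fin n → Fin n → ℝ} (h : IsOrthogonalF Γ) :
    ∃ γ : OrthonormalBasis (Fin n) ℝ (EuclideanSpace ℝ (Fin n)), ∀ k i, (γ k).ofLp i = Γ i k := by
  have h1 : (Matrix.of Γ) * (Matrix.of Γ).transpose = 1 := by
    ext i j
    simpa [Matrix.mul_apply, Matrix.one_apply] using h i j
  have h2 := mul_eq_one_comm.1 h1
  let v : Fin n → EuclideanSpace ℝ (Fin n) := fun k => WithLp.toLp 2 fun i => Γ i k
  have hv : Orthonormal ℝ v := by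
    rw [orthonormal_iff_ite]
    intro i j
    rw [inner_lp]
    have := congrFun (congrFun h2 i) j
    simpa [Matrix.mul_apply, Matrix.one_apply, v] using this
  obtain ⟨b, hb⟩ := Orthonormal.exists_orthonormalBasis_extension_of_card_eq (𝕜 := ℝ)
    (E := EuclideanSpace ℝ (Fin n))
    (ι := Fin n) (by simp) (v := v) (s := Set.univ) (hv.comp _ Subtype.val_injective)
  exact ⟨b, fun k i => by rw [hb _ trivial]⟩

theorem gamma_mul {n : ℕ} {Γ : Fin n → Fin n → ℝ}
    {γ : OrthonormalBasis (Fin n) ℝ (EuclideanSpace ℝ (Fin n))} (hγ : ∀ k i, (γ k).ofLp i = Γ i k)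
    (w : Fin n → ℝ) : mulVecF Γ w = (∑ k, w k • γ k).ofLp := by
  funext i
  simp [mulVecF, hγ, mul_comm]

theorem gamma_tmul {n : ℕ} {Γ : Fin n → Fin n → ℝ} (h : IsOrthogonalF Γ) (y : Fin n → ℝ) :
    mulVecF Γ (tmulVecF Γ y) = y := by
  funext i
  simp only [mulVecF, tmulVecF, Finset.mul_sum]
  rw [Finset.sum_comm]
  simp only [← mul_assoc, ← Finset.sum_mul, h i]
  simp

theorem ortho_space {n : ℕ} (U : Submodule ℝ (Fin n → ℝ)) (v : EuclideanSpace ℝ (Fin n))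
    (hv : v ∈ (U.comap (WithLp.linearEquiv 2 ℝ (Fin n → ℝ)).toLinearMap)ᗮ) :
    ∀ u ∈ U, ∑ i, u i * v.ofLp i = 0 := by
  intro u hu
  have := Submodule.inner_right_of_mem_orthogonal (u := WithLp.toLp 2 u) (by simpa using hu) hv
  rwa [inner_lp] at this

theorem finrank_lp {n : ℕ} (U : Submodule ℝ (Fin n → ℝ)) :
    Module.finrank ℝ (U.comap (WithLp.linearEquiv 2 ℝ (Fin n → ℝ)).toLinearMap) =
      Module.finrank ℝ U := by
  rw [Submodule.comap_equiv_eq_map_symm]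
  exact LinearEquiv.finrank_map_eq _ _

theorem quad_tail {n p : ℕ} (M : Fin n → Fin n → ℝ)
    (hl : ∀ k : Fin n, (k : ℕ) < p → ∀ l, M k l = 0)
    (hr : ∀ k : Fin n, (k : ℕ) < p → ∀ l, M l k = 0) (t : ℝ) (w g : Fin n → ℝ)
    (hw : ∀ k : Fin n, ¬ (k : ℕ) < p → w k = t * g k) :
    quadForm M w = t ^ 2 * quadForm M g := by
  simp only [quadForm, Finset.mul_sum]
  refine Finset.sum_congr rfl fun i _ => Finset.sum_congr rfl fun j _ => ?_
  by_cases hi : (i : ℕ) < p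
  · simp [hl i hi]
  by_cases hj : (j : ℕ) < p
  · simp [hr j hj]
  rw [hw i hi, hw j hj]; ring

/-- The matrix `ΓᵀQΓ`. -/
def conjF {n : ℕ} (γ : Fin n → EuclideanSpace ℝ (Fin n)) (Q : Fin n → Fin n → ℝ) :
    Fin n → Fin n → ℝ := fun k l => ∑ i, (γ k).ofLp i * mulVecF Q (γ l).ofLp i

theorem quad_conj {n : ℕ} (γ : Fin n → EuclideanSpace ℝ (Fin n)) (Q : Fin n → Fin n → ℝ)
    (w : Fin n → ℝ) : quadForm Q (∑ k, w k • γ k).ofLp = quadForm (conjF γ Q) w := by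
  rw [quadForm_eq, mulVecF_sum]
  simp only [quadForm, conjF, WithLp.ofLp_sum, WithLp.ofLp_smul, Finset.sum_apply, Pi.smul_apply,
    smul_eq_mul, Finset.sum_mul, Finset.mul_sum]
  conv_rhs => rw [Finset.sum_comm]
  rw [Finset.sum_comm]
  refine Finset.sum_congr rfl fun k _ => ?_
  rw [Finset.sum_comm]
  refine Finset.sum_congr rfl fun l _ => Finset.sum_congr rfl fun i _ => ?_
  ring

theorem conj_symm {n : ℕ} (γ : Fin n → EuclideanSpace ℝ (Fin n)) (Q : Fin n → Fin n → ℝ)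
    (hQ : ∀ i j, Q i j = Q j i) (k l : Fin n) : conjF γ Q k l = conjF γ Q l k := by
  simp only [conjF, mulVecF, Finset.mul_sum]
  rw [Finset.sum_comm]
  refine Finset.sum_congr rfl fun i _ => Finset.sum_congr rfl fun j _ => ?_
  rw [hQ]; ring

theorem quad_star {n p : ℕ} (γ : Fin n → EuclideanSpace ℝ (Fin n)) (Q : Fin n → Fin n → ℝ)
    (hQ : ∀ i j, Q i j = Q j i) (h : ∀ k : Fin n, (k : ℕ) < p → mulVecF Q (γ k).ofLp = 0)
    (t : ℝ) (w g : Fin n → ℝ) (hw : ∀ k : Fin n, ¬ (k : ℕ) < p → w k = t * g k) :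
    quadForm Q (∑ k, w k • γ k).ofLp = t ^ 2 * quadForm Q (∑ k, g k • γ k).ofLp := by
  rw [quad_conj, quad_conj]
  have hr : ∀ k : Fin n, (k : ℕ) < p → ∀ l, conjF γ Q l k = 0 := fun k hk l => by
    simp [conjF, h k hk]
  exact quad_tail _ (fun k hk l => by rw [conj_symm γ Q hQ]; exact hr k hk l) hr t w g hw

theorem lower_set {n : ℕ} (c : Fin n → ℝ) (hc : ∀ i j : Fin n, i ≤ j → c j ≤ c i) (p : ℕ)
    (hp : (Finset.univ.filter fun k => 0 < c k).card = p) (k : Fin n) :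
    0 < c k ↔ (k : ℕ) < p := by
  constructor
  · intro h
    have : Finset.Iic k ⊆ Finset.univ.filter fun k => 0 < c k := by
      intro j hj
      simp only [Finset.mem_Iic] at hj
      simpa using lt_of_lt_of_le h (hc _ _ hj)
    have := Finset.card_le_card this
    simp at this
    omega
  · intro h
    by_contra hn
    have : (Finset.univ.filter fun k => 0 < c k) ⊆ Finset.Iio k := by
      intro j hj
      simp only [Finset.mem_filter, Finset.mem_univ, true_and] at hj
      simp only [Finset.mem_Iio]
      by_contra hjk
      exact hn (lt_of_lt_of_le hj (hc _ _ (not_lt.1 hjk)))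
    have := Finset.card_le_card this
    simp at this
    omega

theorem quad_sub {n : ℕ} (A B : Fin n → Fin n → ℝ) (v : Fin n → ℝ) :
    mulVecF (A - B) v = mulVecF A v - mulVecF B v := by
  funext i; simp [mulVecF, sub_mul]

theorem mulVecF_id {n : ℕ} (v : Fin n → ℝ) : mulVecF (idF n) v = v := by
  funext i; simp [mulVecF, idF]

/-- Eigenvectors of `ΦΦᵀ` lie in, or are orthogonal to, the column space of `Φ`. -/
theorem eig_dichotomy {n q : ℕ} {Φ : Fin n → Fin q → ℝ} {Kn Γ : Fin n → Fin n → ℝ} {c : Fin n → ℝ}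
    (hKn : ∀ i j, Kn i j = ∑ l, Φ i l * Φ j l) (hE : IsEigenDecomp Kn Γ c)
    {γ : OrthonormalBasis (Fin n) ℝ (EuclideanSpace ℝ (Fin n))} (hγ : ∀ k i, (γ k).ofLp i = Γ i k)
    {P : Fin n → Fin n → ℝ} (hP : IsOrthProjOnto P Φ) (k : Fin n) :
    mulVecF P (γ k).ofLp = (if 0 < c k then (1 : ℝ) else 0) • (γ k).ofLp := by
  obtain ⟨hO, hK, hmono, hnn⟩ := hE
  have hKγ : ∀ i, ∑ j, Kn i j * (γ k).ofLp j = c k * (γ k).ofLp i := by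
    intro i
    have e : ∀ l, ∑ j, Γ j l * (γ k).ofLp j = if l = k then (1:ℝ) else 0 := by
      intro l
      have := γ.inner_eq_ite l k
      rw [inner_lp] at this
      simpa [hγ] using this
    simp only [hK, Finset.sum_mul]
    rw [Finset.sum_comm]
    simp only [mul_assoc, ← Finset.mul_sum, e]
    simp [hγ, mul_comm]
  have hΦ : ∀ i, ∑ l, Φ i l * (∑ j, Φ j l * (γ k).ofLp j) = c k * (γ k).ofLp i := by
    intro i
    rw [← hKγ]
    simp only [hKn, Finset.sum_mul, Finset.mul_sum]
    rw [Finset.sum_comm]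
    simp only [mul_assoc]
  split_ifs with hc
  · rw [one_smul]
    apply proj_fix hP
    have : (γ k).ofLp = ∑ l, ((c k)⁻¹ * (∑ j, Φ j l * (γ k).ofLp j)) • (fun i => Φ i l) := by
      funext i
      simp only [Finset.sum_apply, Pi.smul_apply, smul_eq_mul, mul_assoc, ← Finset.mul_sum]
      simp only [mul_comm _ (Φ i _), hΦ]
      field_simp
    rw [this]
    exact Submodule.sum_mem _ fun l _ => Submodule.smul_mem _ _ (Submodule.subset_span ⟨l, rfl⟩)
  · rw [zero_smul]
    apply proj_kill hP
    have hc0 : c k = 0 := le_antisymm (not_lt.1 hc) (hnn k)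
    have hs : ∑ l, (∑ j, Φ j l * (γ k).ofLp j) ^ 2 = 0 := by
      have : ∑ i, (γ k).ofLp i * ∑ l, Φ i l * (∑ j, Φ j l * (γ k).ofLp j) = 0 := by
        simp [hΦ, hc0]
      rw [← this]
      simp only [Finset.mul_sum (s := (Finset.univ : Finset (Fin q)))]
      rw [Finset.sum_comm]
      refine Finset.sum_congr rfl fun l _ => ?_
      rw [sq]
      nth_rewrite 1 [Finset.sum_mul]
      exact Finset.sum_congr rfl fun i _ => by ring
    have hz := (Finset.sum_eq_zero_iff_of_nonneg fun l _ => sq_nonneg _).1 hs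
    intro u hu
    exact ortho_col (fun l => pow_eq_zero_iff two_ne_zero |>.1 (hz l (Finset.mem_univ l))) hu

theorem col_le {n H q : ℕ} (Z : Fin n → Fin H) (Φ : Fin n → Fin q → ℝ)
    (B : Fin n → Fin H × Fin q → ℝ) (hB : ∀ i hl, B i hl = if Z i = hl.1 then Φ i hl.2 else 0) :
    colSpace Φ ≤ colSpace B := by
  refine Submodule.span_le.2 ?_
  rintro _ ⟨l, rfl⟩
  have : (fun i => Φ i l) = ∑ h, fun i => B i (h, l) := by
    funext i
    simp [hB]
  change (fun i => Φ i l) ∈ colSpace B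
  rw [this]
  exact Submodule.sum_mem _ fun h _ => Submodule.subset_span ⟨(h, l), rfl⟩

end PPT
open PPT in
/-- Theorem 5 of Section 4, `thm:general_F_test`: for a kernel with a
finite-dimensional feature space, the permutation distribution of the F statistic under the
continuous partial permutation test with permutation size `n - p₀` is exactly the F distribution
with degrees of freedom `(p₁ - p₀, n - p₁)`, and the corresponding partial permutation p-value
equals `1 - F_{p₁-p₀, n-p₁}(F(X,Y,Z))`. -/
theorem partial_permutation_F_statistic_exact
    {n d H q : ℕ}
    (X : Fin n → Fin d → ℝ) (Y : Fin n → ℝ) (Z : Fin n → Fin H)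
    -- the feature map defining the kernel K(x,x') = φ(x)ᵀφ(x')
    (φ : (Fin d → ℝ) → Fin q → ℝ)
    -- null design matrix Φ and group-blocked full design matrix B
    (Φmat : Fin n → Fin q → ℝ) (hΦ : ∀ i l, Φmat i l = φ (X i) l)
    (Bmat : Fin n → Fin H × Fin q → ℝ)
    (hB : ∀ i hl, Bmat i hl = if Z i = hl.1 then φ (X i) hl.2 else 0)
    -- the orthogonal projections onto the two column spaces, and their ranks
    (P0 P1 : Fin n → Fin n → ℝ)
    (hP0 : IsOrthProjOnto P0 Φmat) (hP1 : IsOrthProjOnto P1 Bmat)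
    (p0 p1 : ℕ)
    (hp0 : p0 = Module.finrank ℝ (colSpace Φmat))
    (hp1 : p1 = Module.finrank ℝ (colSpace Bmat))
    (hranks : p0 < p1) (hp1n : p1 < n)
    -- nondegeneracy: the observed residual sum of squares under the null model is positive
    (hY : 0 < quadForm (idF n - P0) Y)
    -- the F statistic (as a function of the response vector)
    (Fstat : (Fin n → ℝ) → ℝ)
    (hF : ∀ y, Fstat y =
      (quadForm (P1 - P0) y / ((p1 : ℝ) - p0)) /
        (quadForm (idF n - P1) y / ((n : ℝ) - p1)))
    -- sample kernel matrix and a fixed eigendecomposition Kn = Γ diag(c) Γᵀ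
    (Kn : Fin n → Fin n → ℝ) (hKn : ∀ i j, Kn i j = ∑ l, φ (X i) l * φ (X j) l)
    (Γ : Fin n → Fin n → ℝ) (c : Fin n → ℝ) (hEig : IsEigenDecomp Kn Γ c) :
    -- the permutation distribution of the F statistic is the F distribution
    Measure.map (fun g : Fin n → ℝ => Fstat (mulVecF Γ (wStar (n - p0) (tmulVecF Γ Y) g)))
        (stdGaussianPi n) = Fdist (p1 - p0) (n - p1) ∧
    -- and the continuous partial permutation p-value is 1 - F_{p₁-p₀,n-p₁}(F(X,Y,Z))
    pCont X Z (fun _ y _ => Fstat y) Γ (n - p0) Y =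
      1 - (Fdist (p1 - p0) (n - p1) (Set.Iic (Fstat Y))).toReal := by
  have hE' := hEig
  obtain ⟨hO, -, hmono, hnn⟩ := hE'
  obtain ⟨γ, hγ⟩ := exists_gamma hO
  have hKn' : ∀ i j, Kn i j = ∑ l, Φmat i l * Φmat j l := fun i j => by
    simp only [hKn, hΦ]
  have hB' : ∀ i hl, Bmat i hl = if Z i = hl.1 then Φmat i hl.2 else 0 := fun i hl => by
    simp only [hB, hΦ]
  have hcol : colSpace Φmat ≤ colSpace Bmat := col_le Z Φmat Bmat hB'
  have heig := eig_dichotomy hKn' hEig hγ hP0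
  -- the adapted orthonormal basis
  obtain ⟨b, hbA, hbC, hb0⟩ := exists_basis
    ((colSpace Φmat).comap (WithLp.linearEquiv 2 ℝ (Fin n → ℝ)).toLinearMap)
    ((colSpace Bmat).comap (WithLp.linearEquiv 2 ℝ (Fin n → ℝ)).toLinearMap)
    (Submodule.comap_mono hcol) (p1 - p0) (n - p1) p0
    (by rw [finrank_lp, hp0]) (by rw [finrank_lp, ← hp1]; omega) (by simp; omega)
  have e0 : ∀ k, mulVecF P0 (b k).ofLp =
      (Sum.elim (Sum.elim (fun _ => (0:ℝ)) (fun _ => 0)) (fun _ => 1) k) • (b k).ofLp := by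
    rintro ((i | i) | i)
    · simpa using proj_kill hP0 (ortho_space _ _ (hbA i).2)
    · simpa using proj_kill hP0 (fun u hu => ortho_space _ _ (hbC i) u (hcol hu))
    · simpa using proj_fix hP0 (hb0 i)
  have e1 : ∀ k, mulVecF P1 (b k).ofLp =
      (Sum.elim (Sum.elim (fun _ => (1:ℝ)) (fun _ => 0)) (fun _ => 1) k) • (b k).ofLp := by
    rintro ((i | i) | i)
    · simpa using proj_fix hP1 (hbA i).1
    · simpa using proj_kill hP1 (ortho_space _ _ (hbC i))
    · simpa using proj_fix hP1 (hcol (hb0 i))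
  -- positivity of eigenvalues
  have hpos : ∀ k : Fin n, 0 < c k ↔ (k : ℕ) < p0 := by
    apply lower_set c hmono
    have h1 := trace_of_eig γ P0 _ heig
    rw [trace_of_eig b P0 _ e0] at h1
    simp at h1
    exact_mod_cast h1.symm
  have hbn : n - (n - p0) = p0 := by omega
  -- the radius is positive
  have hs : 0 < Real.sqrt (tailNormSq (n - p0) (tmulVecF Γ Y)) := by
    rw [Real.sqrt_pos]
    have hY' : Y = (∑ k, tmulVecF Γ Y k • γ k).ofLp := by
      rw [← gamma_mul hγ, gamma_tmul hO]
    rw [hY', quad_of_eig γ (idF n - P0) (fun k => if (k : ℕ) < p0 then 0 else 1)] at hY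
    · convert hY using 1
      rw [tailNormSq, Finset.sum_filter, hbn]
      refine Finset.sum_congr rfl fun k _ => ?_
      by_cases hk : (k : ℕ) < p0
      · simp [hk]
      · simp [hk, not_lt.1 hk]
    · intro k
      rw [quad_sub, mulVecF_id, heig]
      simp only [hpos]
      split_ifs <;> simp
  -- the statistic of the partially permuted responses equals that of the Gaussian vector
  have hkey : ∀ g : Fin n → ℝ, Fstat (mulVecF Γ (wStar (n - p0) (tmulVecF Γ Y) g)) =
      Fstat (∑ k, g k • γ k).ofLp := by
    intro g
    set s := Real.sqrt (tailNormSq (n - p0) (tmulVecF Γ Y)) with hsdef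
    set r := Real.sqrt (tailNormSq (n - p0) g) with hrdef
    have hw : ∀ k : Fin n, ¬ (k : ℕ) < p0 →
        wStar (n - p0) (tmulVecF Γ Y) g k = (s / r) * g k := by
      intro k hk
      simp only [wStar, hbn, hk, if_false]
      ring
    have hk10 : ∀ k : Fin n, (k : ℕ) < p0 → mulVecF (P1 - P0) (γ k).ofLp = 0 := by
      intro k hk
      have h0 : mulVecF P0 (γ k).ofLp = (γ k).ofLp := by rw [heig, if_pos ((hpos k).2 hk), one_smul]
      have hm : (γ k).ofLp ∈ colSpace Φmat := by
        rw [← hP0.2.2, ← h0]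
        have : mulVecF P0 (γ k).ofLp = ∑ j, (γ k).ofLp j • (fun i => P0 i j) := by
          funext i; simp [mulVecF, mul_comm]
        rw [this]
        exact Submodule.sum_mem _ fun l _ =>
          Submodule.smul_mem _ _ (Submodule.subset_span ⟨l, rfl⟩)
      rw [quad_sub, h0, proj_fix hP1 (hcol hm), sub_self]
    have hk1 : ∀ k : Fin n, (k : ℕ) < p0 → mulVecF (idF n - P1) (γ k).ofLp = 0 := by
      intro k hk
      have h0 : mulVecF P0 (γ k).ofLp = (γ k).ofLp := by rw [heig, if_pos ((hpos k).2 hk), one_smul]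
      have := hk10 k hk
      rw [quad_sub, h0, sub_eq_zero] at this
      rw [quad_sub, mulVecF_id, this, sub_self]
    have s10 : ∀ i j, (P1 - P0) i j = (P1 - P0) j i := fun i j => by
      simp [hP1.1 i j, hP0.1 i j]
    have s1 : ∀ i j, (idF n - P1) i j = (idF n - P1) j i := fun i j => by
      simp [hP1.1 i j, idF, eq_comm]
    rw [gamma_mul hγ, hF, hF, quad_star (⇑γ) _ s10 hk10 (s / r) _ g hw,
      quad_star (⇑γ) _ s1 hk1 (s / r) _ g hw]
    by_cases hr : r = 0
    · have hg : ∀ k : Fin n, ¬ (k : ℕ) < p0 → g k = 0 * g k := by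
        intro k hk
        have h1 : tailNormSq (n - p0) g = 0 :=
          (Real.sqrt_eq_zero (Finset.sum_nonneg fun i _ => sq_nonneg (g i))).1 hr
        have h2 := (Finset.sum_eq_zero_iff_of_nonneg fun i _ => sq_nonneg (g i)).1 h1 k
          (by simp only [hbn, Finset.mem_filter, Finset.mem_univ, true_and]; omega)
        rw [pow_eq_zero_iff two_ne_zero] at h2
        rw [h2, mul_zero]
      have z := quad_star (⇑γ) _ s10 hk10 0 g g hg
      rw [zero_pow two_ne_zero, zero_mul] at z
      rw [z]
      simp
    · have ht : (s / r) ^ 2 ≠ 0 := pow_ne_zero 2 (div_ne_zero hs.ne' hr)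
      rw [mul_div_assoc (_ ^ 2) _ (_ - _), mul_div_assoc (_ ^ 2) _ (_ - _), mul_div_mul_left _ _ ht]
  have hFm : Measurable fun x : EuclideanSpace ℝ (Fin n) => Fstat x.ofLp := by
    simp only [hF, quadForm]
    fun_prop
  have hlaw : Measure.map
      (fun g : Fin n → ℝ => Fstat (mulVecF Γ (wStar (n - p0) (tmulVecF Γ Y) g)))
        (stdGaussianPi n) = Fdist (p1 - p0) (n - p1) := by
    simp only [hkey]
    have h1 := stdGaussian_eq_map_pi_orthonormalBasis γ
    rw [stdGaussian_eq_map_pi_orthonormalBasis b] at h1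
    have h2 := congrArg (Measure.map fun x : EuclideanSpace ℝ (Fin n) => Fstat x.ofLp) h1
    rw [Measure.map_map hFm (by fun_prop), Measure.map_map hFm (by fun_prop)] at h2
    refine Eq.trans h2.symm ?_
    rw [Fdist, ← pi_sum_law (p1 - p0) (n - p1) p0 _ (by fun_prop)]
    congr 1
    funext x
    simp only [Function.comp_apply, hF]
    rw [quad_of_eig b (P1 - P0) (Sum.elim (Sum.elim (fun _ => 1) (fun _ => 0)) (fun _ => 0)),
      quad_of_eig b (idF n - P1) (Sum.elim (Sum.elim (fun _ => 0) (fun _ => 1)) (fun _ => 0))]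
    · simp [Nat.cast_sub hranks.le, Nat.cast_sub hp1n.le]
    · intro k
      rw [quad_sub, mulVecF_id, e1]
      rcases k with (k | k) | k <;> simp
    · intro k
      rw [quad_sub, e0, e1]
      rcases k with (k | k) | k <;> simp
  refine ⟨hlaw, ?_⟩
  have hgm : Measurable
      (fun g : Fin n → ℝ => Fstat (mulVecF Γ (wStar (n - p0) (tmulVecF Γ Y) g))) := by
    simp only [hkey]
    exact hFm.comp (by fun_prop)
  have hprob : IsProbabilityMeasure (Fdist (p1 - p0) (n - p1)) := by
    rw [← hlaw]
    exact Measure.isProbabilityMeasure_map hgm.aemeasurable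
  rw [← pval_law _ _ (Fdist_atom _ _ (by omega) (by omega) _), ← hlaw,
    Measure.map_apply hgm measurableSet_Ici]
  rfl
end
end

section
/- Fix n ≥ 1, a covariate matrix X ∈ ℝ^{n×d}, group labels Z ∈ {1,…,H}ⁿ, a measurable function f₀ : ℝᵈ → ℝ, σ₀ > 0, and a known positive definite matrix Σ ∈ ℝ^{n×n}, and suppose Y = f₀(X) + ε with ε ~ N(0, σ₀²·Σ). Fix a symmetric positive semidefinite kernel K, a permutation size b ∈ {1,…,n}, any test statistic T, and α₀ ∈ (0,1). Let γ_1,…,γ_n be the ordered eigenvectors of K_n^C = Σ^{−1/2}K_nΣ^{−1/2}, define ω_C(b, σ₀⁻¹f₀, Σ) = σ₀⁻² Σ_{i=n−b+1}^n (γ_iᵀ Σ^{−1/2} f₀(X))² and v_C(b, σ₀⁻¹f₀, Σ, α₀) = (1/2)·exp{2·√(2·ω_C)·√(Q_b(1−α₀) + ω_C)} − 1/2. Then the corrected partial permutation p-value p_c(X,Y,Z,Σ) = p(X,Y,Z,Σ) + v_C(b, σ₀⁻¹f₀, Σ, α₀) + α₀ (with p either the discrete or the continuous partial permutation p-value with covariance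 matrix Σ) is valid: Pr(p_c(X,Y,Z,Σ) ≤ α) ≤ α for every α ∈ (0,1). -/
open MeasureTheory ProbabilityTheory Filter

noncomputable section

namespace PPT

/-- A square matrix (as a function) is symmetric. -/
def IsSymmF {n : ℕ} (A : Fin n → Fin n → ℝ) : Prop := ∀ i j, A i j = A j i

/-- A square matrix (as a function) is symmetric positive definite. -/
def IsPosDefF {n : ℕ} (A : Fin n → Fin n → ℝ) : Prop :=
  IsSymmF A ∧ ∀ v : Fin n → ℝ, v ≠ 0 → 0 < quadForm A v

/-- `(Sh, R)` is the pair `(Σ^{1/2}, Σ^{-1/2})` associated with the positive definite matrix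
`Sm`: `Sh` is the symmetric positive definite square root of `Sm` and `R` is its inverse. -/
def IsSqrtPair {n : ℕ} (Sm Sh R : Fin n → Fin n → ℝ) : Prop :=
  IsPosDefF Sh ∧ mulF Sh Sh = Sm ∧ mulF R Sh = idF n ∧ mulF Sh R = idF n

end PPT

namespace PPT

lemma pi_gauss_density {ι : Type*} [Fintype ι] (m : ι → ℝ) :
    Measure.pi (fun i => gaussianReal (m i) 1) =
      (volume : Measure (ι → ℝ)).withDensity
        (fun x => ENNReal.ofReal (∏ i, gaussianPDFReal (m i) 1 (x i))) := by
  refine (Measure.pi_eq fun s hs => ?_)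
  rw [withDensity_apply _ (MeasurableSet.univ_pi hs), volume_pi, Measure.restrict_pi_pi,
    ← ofReal_integral_eq_lintegral_ofReal]
  · rw [integral_fintype_prod_eq_prod (f := fun i x => gaussianPDFReal (m i) 1 x),
      ENNReal.ofReal_prod_of_nonneg]
    · refine Finset.prod_congr rfl fun i _ => ?_
      rw [gaussianReal_apply_eq_integral _ one_ne_zero]
    · intro i _
      exact integral_nonneg fun x => gaussianPDFReal_nonneg _ _ _
  · exact Integrable.fintype_prod (f := fun i x => gaussianPDFReal (m i) 1 x)
      fun i => (integrable_gaussianPDFReal _ _).restrict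
  · exact ae_of_all _ fun x => Finset.prod_nonneg fun i _ => gaussianPDFReal_nonneg _ _ _

lemma pi_gauss_shift {ι : Type*} [Fintype ι] (δ : ι → ℝ) :
    (Measure.pi (fun _ : ι => gaussianReal 0 1)).map (fun g => g + δ) =
      (Measure.pi (fun _ : ι => gaussianReal 0 1)).withDensity
        (fun x => ENNReal.ofReal (Real.exp (∑ i, δ i * x i - (∑ i, δ i ^ 2) / 2))) := by
  have h1 : (Measure.pi (fun _ : ι => gaussianReal 0 1)).map (fun g => g + δ) =
      Measure.pi (fun i => gaussianReal (δ i) 1) := by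
    have h2 : ∀ i, gaussianReal (δ i) 1 = (gaussianReal 0 1).map (fun x => x + δ i) := by
      intro i; rw [gaussianReal_map_add_const]; simp
    simp_rw [h2]
    rw [← Measure.pi_map_pi (fun i => by fun_prop)]
    rfl
  rw [h1, pi_gauss_density, pi_gauss_density (fun _ => 0), ← withDensity_mul]
  · congr 1
    ext x
    simp only [Pi.mul_apply]
    rw [← ENNReal.ofReal_mul (Finset.prod_nonneg fun i _ => gaussianPDFReal_nonneg _ _ _)]
    congr 1
    rw [Finset.sum_div, ← Finset.sum_sub_distrib, Real.exp_sum, ← Finset.prod_mul_distrib]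
    refine Finset.prod_congr rfl fun i _ => ?_
    simp only [gaussianPDFReal, NNReal.coe_one]
    rw [mul_assoc (√_)⁻¹, ← Real.exp_add]
    congr 2
    ring
  · have := measurable_gaussianPDFReal 0 1
    fun_prop
  · fun_prop

/-- polar representation of the Gaussian. -/
lemma gauss_polar {ι : Type*} [Fintype ι] [Nonempty ι] :
    ∃ ρ : Measure (Set.Ioi (0:ℝ)), SFinite ρ ∧ ∀ F : (ι → ℝ) → ENNReal, Measurable F →
      ∫⁻ x, F x ∂(Measure.pi (fun _ : ι => gaussianReal 0 1)) =
      ∫⁻ r, ∫⁻ u, F (WithLp.ofLp ((r : ℝ) • (u : EuclideanSpace ℝ ι))) 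
        ∂(volume : Measure (EuclideanSpace ℝ ι)).toSphere ∂ρ := by
  let D : ℝ → ENNReal := fun q => ENNReal.ofReal ((√(2 * Real.pi))⁻¹ ^ (Fintype.card ι) *
    Real.exp (- q / 2))
  have hD : Measurable D := by fun_prop
  have hdens : Measure.pi (fun _ : ι => gaussianReal 0 1) =
      (volume : Measure (ι → ℝ)).withDensity (fun x => D (∑ i, x i ^ 2)) := by
    rw [pi_gauss_density]
    congr 1
    ext x
    simp only [D]
    congr 1
    simp only [gaussianPDFReal, Finset.prod_mul_distrib, ← Real.exp_sum]
    simp [← Finset.sum_div, ← Finset.sum_neg_distrib]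
  refine ⟨(Measure.volumeIoiPow (Module.finrank ℝ (EuclideanSpace ℝ ι) - 1)).withDensity
    (fun r => D ((r:ℝ)^2)), inferInstance, fun F hF => ?_⟩
  rw [hdens, lintegral_withDensity_eq_lintegral_mul _ (by fun_prop) hF]
  rw [← (EuclideanSpace.volume_preserving_symm_measurableEquiv_toLp ι).lintegral_comp_emb
    (MeasurableEquiv.measurableEmbedding _)]
  set G : EuclideanSpace ℝ ι → ENNReal := fun a => 
    ((fun x : ι → ℝ => D (∑ i, x i ^ 2)) * F) ((MeasurableEquiv.toLp 2 (ι → ℝ)).symm a) with hG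
  have hGm : Measurable G := by
    apply Measurable.comp _ (MeasurableEquiv.measurable _)
    exact Measurable.mul (by fun_prop) hF
  have e1 : ∫⁻ a, G a = ∫⁻ a : ({0}ᶜ : Set (EuclideanSpace ℝ ι)), G a
      ∂(volume.comap Subtype.val) := by
    rw [lintegral_subtype_comap (measurableSet_singleton _).compl]
    rw [restrict_compl_singleton]
  have mp := Measure.measurePreserving_homeomorphUnitSphereProd
    (volume : Measure (EuclideanSpace ℝ ι))
  have e2 : ∫⁻ a : ({0}ᶜ : Set (EuclideanSpace ℝ ι)), G a ∂(volume.comap Subtype.val)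
      = ∫⁻ p, G ((p.2 : ℝ) • (p.1 : EuclideanSpace ℝ ι)) ∂((volume : Measure (EuclideanSpace ℝ ι)).toSphere.prod
      (Measure.volumeIoiPow (Module.finrank ℝ (EuclideanSpace ℝ ι) - 1))) := by
    rw [← mp.lintegral_comp_emb (Homeomorph.measurableEmbedding _)]
    refine lintegral_congr fun a => ?_
    congr 1
    exact (congrArg Subtype.val ((homeomorphUnitSphereProd _).symm_apply_apply a)).symm
  have hm2 : Measurable fun p : (Metric.sphere (0:EuclideanSpace ℝ ι) 1) × Set.Ioi (0:ℝ) =>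
    G ((p.2 : ℝ) • (p.1 : EuclideanSpace ℝ ι)) := by fun_prop
  have hF' : Measurable fun p : (Metric.sphere (0:EuclideanSpace ℝ ι) 1) × Set.Ioi (0:ℝ) =>
    F (WithLp.ofLp ((p.2 : ℝ) • (p.1 : EuclideanSpace ℝ ι))) := by 
    apply hF.comp
    fun_prop
  rw [e1, e2, lintegral_prod_symm _ hm2.aemeasurable]
  rw [lintegral_withDensity_eq_lintegral_mul _ (by fun_prop)]
  · refine lintegral_congr fun r => ?_
    simp only [Pi.mul_apply]
    rw [← lintegral_const_mul]
    · refine lintegral_congr fun u => ?_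
      simp only [hG, Pi.mul_apply]
      congr 2
      have : ‖((r : ℝ) • (u : EuclideanSpace ℝ ι))‖^2 = (r:ℝ)^2 := by
        rw [norm_smul]; simp
      rw [← this, EuclideanSpace.real_norm_sq_eq]
      rfl
    · exact hF'.comp (measurable_id.prodMk measurable_const)
  · exact hF'.lintegral_prod_left'

lemma gauss_sphere {ι : Type*} [Fintype ι] [Nonempty ι] (F : (ι → ℝ) → ENNReal)
    (hF : Measurable F) :
    ∫⁻ w, ∫⁻ g, F (fun i => √(∑ i, w i ^ 2) * g i / √(∑ i, g i ^ 2)) 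
      ∂(Measure.pi (fun _ : ι => gaussianReal 0 1)) ∂(Measure.pi (fun _ : ι => gaussianReal 0 1))
    = ∫⁻ w, F w ∂(Measure.pi (fun _ : ι => gaussianReal 0 1)) := by
  obtain ⟨ρ, _, h⟩ := gauss_polar (ι := ι)
  have hm : Measurable (fun p : (ι → ℝ) × (ι → ℝ) =>
    F (fun i => √(∑ i, p.1 i ^ 2) * p.2 i / √(∑ i, p.2 i ^ 2))) := by
    apply hF.comp; fun_prop
  have h1 := h (fun _ => 1) measurable_const
  simp only [lintegral_const, measure_univ, mul_one, one_mul] at h1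
  have hsq : ∀ (r : Set.Ioi (0:ℝ)) (u : Metric.sphere (0:EuclideanSpace ℝ ι) 1),
      √(∑ i, (WithLp.ofLp ((r : ℝ) • (u : EuclideanSpace ℝ ι))) i ^ 2) = r := by
    intro r u
    rw [← EuclideanSpace.real_norm_sq_eq, Real.sqrt_sq (norm_nonneg _), norm_smul]
    simp [abs_of_pos r.2.out]
  have hinner : ∀ w : ι → ℝ, ∫⁻ g, F (fun i => √(∑ i, w i ^ 2) * g i / √(∑ i, g i ^ 2)) 
      ∂(Measure.pi (fun _ : ι => gaussianReal 0 1)) = 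
      ρ Set.univ * ∫⁻ u, F (WithLp.ofLp (√(∑ i, w i ^ 2) • (u : EuclideanSpace ℝ ι))) 
        ∂(volume : Measure (EuclideanSpace ℝ ι)).toSphere := by
    intro w
    rw [h (fun g => F (fun i => √(∑ i, w i ^ 2) * g i / √(∑ i, g i ^ 2)))
      (hm.comp (measurable_const (a := w) |>.prodMk measurable_id))]
    rw [mul_comm, ← lintegral_const]
    refine lintegral_congr fun r => lintegral_congr fun u => ?_
    congr 1
    ext i
    simp only [hsq]
    have : (r:ℝ) ≠ 0 := r.2.out.ne'
    simp
    field_simp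
  simp_rw [hinner]
  have hm3 : Measurable fun p : (ι → ℝ) × (Metric.sphere (0:EuclideanSpace ℝ ι) 1) =>
      F (WithLp.ofLp (√(∑ i, p.1 i ^ 2) • (p.2 : EuclideanSpace ℝ ι))) := by
    apply hF.comp; fun_prop
  rw [lintegral_const_mul _ hm3.lintegral_prod_right', h _ hm3.lintegral_prod_right']
  simp_rw [hsq]
  simp only [lintegral_const]
  have hm4 : Measurable fun p : Set.Ioi (0:ℝ) × (Metric.sphere (0:EuclideanSpace ℝ ι) 1) =>
      F (WithLp.ofLp ((p.1:ℝ) • (p.2 : EuclideanSpace ℝ ι))) := by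
    apply hF.comp; fun_prop
  rw [lintegral_mul_const _ hm4.lintegral_prod_right', h F hF, mul_comm, mul_assoc, ← h1, mul_one]

end PPT
namespace PPT

instance stdG_prob (k : ℕ) : IsProbabilityMeasure (stdGaussianPi k) := by
  unfold stdGaussianPi; infer_instance

lemma inv_abs {V A T : Type*} [MeasurableSpace V] [MeasurableSpace A] [MeasurableSpace T]
    (μ : Measure V) (μA : Measure A) (μT : Measure T) [IsProbabilityMeasure μA]
    [IsProbabilityMeasure μT] (e : V ≃ᵐ A × T) (mp : MeasurePreserving e μ (μA.prod μT))
    (sph : T → T → T) (hsph : Measurable fun q : T × T => sph q.1 q.2)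
    (hinv : ∀ F : T → ENNReal, Measurable F → ∫⁻ w, ∫⁻ g, F (sph w g) ∂μT ∂μT = ∫⁻ w, F w ∂μT)
    (F : V → ENNReal) (hF : Measurable F) :
    ∫⁻ w, ∫⁻ g, F (e.symm ((e w).1, sph (e w).2 (e g).2)) ∂μ ∂μ = ∫⁻ w, F w ∂μ := by
  have h1 : ∀ w : V, ∫⁻ g, F (e.symm ((e w).1, sph (e w).2 (e g).2)) ∂μ
      = ∫⁻ t, F (e.symm ((e w).1, sph (e w).2 t)) ∂μT := by
    intro w
    have hm : Measurable (fun t => F (e.symm ((e w).1, sph (e w).2 t))) := by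
      apply hF.comp
      apply e.symm.measurable.comp
      apply measurable_const.prodMk
      exact hsph.comp (measurable_const.prodMk measurable_id)
    rw [mp.lintegral_comp_emb e.measurableEmbedding
      (fun x => F (e.symm ((e w).1, sph (e w).2 x.2)))]
    have hm' : Measurable (fun x : A × T => F (e.symm ((e w).1, sph (e w).2 x.2))) :=
      hm.comp measurable_snd
    rw [lintegral_prod _ hm'.aemeasurable]
    simp
  simp_rw [h1]
  have hm2 : Measurable (fun q : (A × T) × T => F (e.symm (q.1.1, sph q.1.2 q.2))) := by
    apply hF.comp
    apply e.symm.measurable.comp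
    apply (measurable_fst.comp measurable_fst).prodMk
    exact hsph.comp ((measurable_snd.comp measurable_fst).prodMk measurable_snd)
  rw [mp.lintegral_comp_emb e.measurableEmbedding
      (fun x => ∫⁻ t, F (e.symm (x.1, sph x.2 t)) ∂μT)]
  rw [lintegral_prod _ (hm2.lintegral_prod_right').aemeasurable]
  have h2 : ∫⁻ w, F w ∂μ = ∫⁻ w, F (e.symm (e w)) ∂μ := by simp
  rw [h2, mp.lintegral_comp_emb e.measurableEmbedding (fun x => F (e.symm x)),
    lintegral_prod (fun x => F (e.symm x)) (hF.comp e.symm.measurable).aemeasurable]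
  refine lintegral_congr fun h => ?_
  exact hinv (fun t => F (e.symm (h, t)))
    (hF.comp (e.symm.measurable.comp (measurable_const.prodMk measurable_id)))

lemma wStar_inv {n b : ℕ} (hb1 : 1 ≤ b) (hb2 : b ≤ n) (F : (Fin n → ℝ) → ENNReal)
    (hF : Measurable F) :
    ∫⁻ w, ∫⁻ g, F (wStar b w g) ∂stdGaussianPi n ∂stdGaussianPi n =
      ∫⁻ w, F w ∂stdGaussianPi n := by
  let p : Fin n → Prop := fun i => (i : ℕ) < n - b
  let e := MeasurableEquiv.piEquivPiSubtypeProd (fun _ : Fin n => ℝ) p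
  have mp : MeasurePreserving e (stdGaussianPi n)
      ((Measure.pi (fun _ : {i // p i} => gaussianReal 0 1)).prod
        (Measure.pi (fun _ : {i // ¬ p i} => gaussianReal 0 1))) :=
    measurePreserving_piEquivPiSubtypeProd (fun _ : Fin n => gaussianReal 0 1) p
  have : Nonempty {i // ¬ p i} := ⟨⟨⟨n - 1, by omega⟩, by simp only [p]; omega⟩⟩
  let sph : ({i // ¬ p i} → ℝ) → ({i // ¬ p i} → ℝ) → ({i // ¬ p i} → ℝ) := fun w g i =>
    √(∑ i, w i ^ 2) * g i / √(∑ i, g i ^ 2)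
  have htail : ∀ w : Fin n → ℝ, tailNormSq b w = ∑ i, (e w).2 i ^ 2 := by
    intro w
    unfold tailNormSq
    rw [Finset.sum_subtype (p := fun i => ¬ p i)]
    · rfl
    · intro x; simp [p]
  have hstar : ∀ w g : Fin n → ℝ, wStar b w g = e.symm ((e w).1, sph (e w).2 (e g).2) := by
    intro w g
    rw [MeasurableEquiv.eq_symm_apply] 
    refine Prod.ext ?_ ?_
    · ext ⟨i, hi⟩
      change wStar b w g i = w i
      simp only [wStar]
      rw [if_pos hi]
    · ext ⟨i, hi⟩
      change wStar b w g i = _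
      simp only [wStar]
      rw [if_neg hi, htail, htail]
      rfl
  have hsph : Measurable fun q : ({i // ¬ p i} → ℝ) × ({i // ¬ p i} → ℝ) => sph q.1 q.2 := by
    simp only [sph]
    fun_prop
  simp_rw [hstar]
  exact inv_abs _ _ _ e mp sph hsph (fun G hG => gauss_sphere G hG) F hF

lemma map_comp_inj {k n : ℕ} (e : Fin k → Fin n) (he : Function.Injective e) :
    (stdGaussianPi n).map (fun g => g ∘ e) = stdGaussianPi k := by
  have h0 : iIndepFun (fun (i : Fin n) (ω : Fin n → ℝ) => ω i) (stdGaussianPi n) :=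
    iIndepFun_pi (X := fun _ x => x) (fun i => by fun_prop)
  have h1 := h0.precomp he
  have h2 := (iIndepFun_iff_map_fun_eq_pi_map
    (fun i => (measurable_pi_apply (e i)).aemeasurable)).1 h1
  refine Eq.trans h2 ?_
  unfold stdGaussianPi
  congr 1
  ext1 i
  exact (measurePreserving_eval (fun _ : Fin n => gaussianReal 0 1) (e i)).map_eq

lemma rotate {n : ℕ} (Γ : Fin n → Fin n → ℝ) (hΓ : IsOrthogonalF Γ) :
    (stdGaussianPi n).map (tmulVecF Γ) = stdGaussianPi n := by
  let U : Matrix (Fin n) (Fin n) ℝ := Matrix.of Γ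
  have hU : U * U.transpose = 1 := by
    ext i j
    simp [U, Matrix.mul_apply, hΓ i j, Matrix.one_apply]
  have hU' : U.transpose * U = 1 := mul_eq_one_comm.1 hU
  let f : EuclideanSpace ℝ (Fin n) →ₗᵢ[ℝ] EuclideanSpace ℝ (Fin n) :=
    { toLinearMap := Matrix.toEuclideanLin U.transpose
      norm_map' := by
        intro x
        have : ‖Matrix.toEuclideanLin U.transpose x‖^2 = ‖x‖^2 := by
          rw [EuclideanSpace.real_norm_sq_eq, EuclideanSpace.real_norm_sq_eq]
          have e1 : ∀ y : Fin n → ℝ, ∑ i, y i ^ 2 = y ⬝ᵥ y := by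
            intro y; simp [dotProduct, pow_two]
          rw [e1, e1]
          simp only [Matrix.toLpLin_apply]
          rw [Matrix.dotProduct_mulVec, Matrix.vecMul_transpose, Matrix.mulVec_mulVec, hU,
            Matrix.one_mulVec]
        exact (sq_eq_sq₀ (norm_nonneg _) (norm_nonneg _)).1 this }
  let f' := f.toLinearIsometryEquiv rfl
  have key := stdGaussian_map f'
  have h2 := map_pi_eq_stdGaussian (ι := Fin n)
  rw [← h2] at key
  have hmeas : Measurable (tmulVecF Γ) := by
    unfold tmulVecF; fun_prop
  rw [Measure.map_map (by fun_prop) (by fun_prop)] at key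
  have h3 := congrArg (Measure.map (WithLp.ofLp)) key
  rw [Measure.map_map (by fun_prop) (by fun_prop), Measure.map_map (by fun_prop) (by fun_prop)] at h3
  have h4 : (WithLp.ofLp ∘ WithLp.toLp 2 : (Fin n → ℝ) → (Fin n → ℝ)) = id := rfl
  rw [h4, Measure.map_id] at h3
  refine Eq.trans ?_ h3
  unfold stdGaussianPi
  congr 1

lemma avg_bound {Ω : Type*} [MeasurableSpace Ω] (γ : Measure Ω) [IsProbabilityMeasure γ]
    (r : Ω → ℝ) (hr : Measurable r) (hpos : ∀ g, 0 < r g) (E : ℝ) (hE : 0 ≤ E)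
    (hrat : ∀ g g', r g ≤ Real.exp E * r g') (A : Set Ω) (hA : MeasurableSet A) (a : ℝ)
    (ha : 0 ≤ a) (hγ : γ A ≤ ENNReal.ofReal a) :
    ∫⁻ g in A, ENNReal.ofReal (r g) ∂γ ≤
      ENNReal.ofReal (a + (1 / 2 * Real.exp E - 1 / 2)) * ∫⁻ g, ENNReal.ofReal (r g) ∂γ := by
  obtain ⟨g0⟩ : Nonempty Ω := γ.nonempty_of_neZero
  have hrint : Integrable r γ := by
    refine Integrable.of_bound hr.aestronglyMeasurable (Real.exp E * r g0) (ae_of_all _ fun g => ?_)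
    rw [Real.norm_of_nonneg (hpos g).le]
    exact hrat g g0
  have h1E : 1 ≤ Real.exp E := Real.one_le_exp hE
  rw [← ofReal_integral_eq_lintegral_ofReal hrint (ae_of_all _ fun g => (hpos g).le),
    ← ofReal_integral_eq_lintegral_ofReal hrint.integrableOn (ae_of_all _ fun g => (hpos g).le),
    ← ENNReal.ofReal_mul (by linarith)]
  apply ENNReal.ofReal_le_ofReal
  set M := ∫ g, r g ∂γ with hM
  have hM0 : 0 ≤ M := integral_nonneg fun g => (hpos g).le
  have hup : ∀ g, r g ≤ Real.exp E * M := by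
    intro g
    have : ∫ _, r g ∂γ ≤ ∫ g', Real.exp E * r g' ∂γ :=
      integral_mono (integrable_const _) (hrint.const_mul _) fun g' => hrat g g'
    rw [integral_const_mul] at this
    simpa using this
  have hlo : ∀ g, Real.exp (-E) * M ≤ r g := by
    intro g
    have : ∫ g', r g' ∂γ ≤ ∫ _, Real.exp E * r g ∂γ :=
      integral_mono hrint (integrable_const _) fun g' => hrat g' g
    have h2 : M ≤ Real.exp E * r g := by simpa using this
    calc Real.exp (-E) * M ≤ Real.exp (-E) * (Real.exp E * r g) := by gcongr
      _ = r g := by rw [← mul_assoc, ← Real.exp_add]; simp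
  set p := γ.real A with hp
  have hp0 : 0 ≤ p := measureReal_nonneg
  have hp1 : p ≤ 1 := measureReal_le_one
  have hpa : p ≤ a := ENNReal.toReal_le_of_le_ofReal ha hγ
  have u1 : ∫ g in A, r g ∂γ ≤ p * (Real.exp E * M) := by
    have : ∫ g in A, r g ∂γ ≤ ∫ g in A, Real.exp E * M ∂γ :=
      integral_mono hrint.integrableOn (integrable_const _) fun g => hup g
    simpa [hp] using this
  have u2 : (1 - p) * (Real.exp (-E) * M) ≤ ∫ g in Aᶜ, r g ∂γ := by
    have : ∫ g in Aᶜ, Real.exp (-E) * M ∂γ ≤ ∫ g in Aᶜ, r g ∂γ :=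
      integral_mono (integrable_const _) hrint.integrableOn fun g => hlo g
    simpa [hp, probReal_compl_eq_one_sub hA] using this
  have u3 := integral_add_compl hA hrint
  have h4 : Real.exp (-E) * Real.exp E = 1 := by rw [← Real.exp_add]; simp
  have hx : 0 < Real.exp (-E) := Real.exp_pos _
  generalize Real.exp (-E) = x at *
  generalize Real.exp E = y at *
  have hxy : 2 ≤ x + y := by nlinarith [sq_nonneg (y - 1)]
  rcases le_total p (1/2) with h | h
  · refine u1.trans ?_
    have : p * y ≤ a + (1 / 2 * y - 1 / 2) := by nlinarith
    calc p * (y * M) = (p * y) * M := by ring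
      _ ≤ _ := by gcongr
  · have : 1 - (1 - p) * x ≤ a + (1 / 2 * y - 1 / 2) := by nlinarith
    calc ∫ g in A, r g ∂γ ≤ M - (1 - p) * (x * M) := by linarith
      _ = (1 - (1 - p) * x) * M := by ring
      _ ≤ _ := by gcongr

lemma core {V Ω : Type*} [MeasurableSpace V] [MeasurableSpace Ω] (ν : Measure V) 
    (γ : Measure Ω) [IsProbabilityMeasure γ] (θ : V → Ω → V)
    (hθ : Measurable (Function.uncurry θ))
    (hinv : ∀ F : V → ENNReal, Measurable F → ∫⁻ w, ∫⁻ g, F (θ w g) ∂γ ∂ν = ∫⁻ w, F w ∂ν)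
    (A B : Set V) (hA : MeasurableSet A) (hB : MeasurableSet B) (a : ℝ) (ha : 0 ≤ a)
    (hγ : ∀ w, γ {g | θ w g ∈ A} ≤ ENNReal.ofReal a)
    (L : V → ℝ) (hL : Measurable L) (hpos : ∀ w, 0 < L w) (E : ℝ) (hE : 0 ≤ E)
    (hBinv : ∀ w, ∀ᵐ g ∂γ, (θ w g ∈ B ↔ w ∈ B))
    (hrat : ∀ w ∈ B, ∀ g g', L (θ w g) ≤ Real.exp E * L (θ w g')) :
    ∫⁻ w in A ∩ B, ENNReal.ofReal (L w) ∂ν ≤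
      ENNReal.ofReal (a + (1 / 2 * Real.exp E - 1 / 2)) * ∫⁻ w in B, ENNReal.ofReal (L w) ∂ν := by
  have hθw : ∀ w, Measurable (θ w) := fun w => hθ.comp (measurable_const.prodMk measurable_id)
  rw [← lintegral_indicator (hA.inter hB), ← lintegral_indicator hB,
    ← hinv _ (hL.ennreal_ofReal.indicator (hA.inter hB)), ← hinv _ (hL.ennreal_ofReal.indicator hB),
    ← lintegral_const_mul']
  swap
  · exact ENNReal.ofReal_ne_top
  refine lintegral_mono fun w => ?_
  by_cases hw : w ∈ B
  · have e1 : ∫⁻ g, (A ∩ B).indicator (fun w => ENNReal.ofReal (L w)) (θ w g) ∂γ =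
        ∫⁻ g in {g | θ w g ∈ A}, ENNReal.ofReal (L (θ w g)) ∂γ := by
      have hs : MeasurableSet {g | θ w g ∈ A} := hθw w hA
      rw [← lintegral_indicator hs]
      refine lintegral_congr_ae ?_
      filter_upwards [hBinv w] with g hg
      by_cases h : θ w g ∈ A
      · rw [Set.indicator_of_mem (s := A ∩ B) ⟨h, hg.2 hw⟩,
          Set.indicator_of_mem (s := {g | θ w g ∈ A}) h]
      · rw [Set.indicator_of_notMem (s := A ∩ B) (fun hh => h hh.1),
          Set.indicator_of_notMem (s := {g | θ w g ∈ A}) h]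
    have e2 : ∫⁻ g, B.indicator (fun w => ENNReal.ofReal (L w)) (θ w g) ∂γ =
        ∫⁻ g, ENNReal.ofReal (L (θ w g)) ∂γ := by
      refine lintegral_congr_ae ?_
      filter_upwards [hBinv w] with g hg
      simp [Set.indicator, hg, hw]
    rw [e1, e2]
    exact avg_bound γ (fun g => L (θ w g)) (hL.comp (hθw w)) (fun g => hpos _) E hE (hrat w hw) _
      (hθw w hA) a ha (hγ w)
  · have e1 : ∫⁻ g, (A ∩ B).indicator (fun w => ENNReal.ofReal (L w)) (θ w g) ∂γ = 0 := by
      rw [← lintegral_zero (μ := γ)]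
      refine lintegral_congr_ae ?_
      filter_upwards [hBinv w] with g hg
      simp [Set.indicator, hg, hw]
    rw [e1]
    exact zero_le

lemma rank_valid {Ω : Type*} [MeasurableSpace Ω] (γ : Measure Ω) [IsProbabilityMeasure γ]
    (S : Ω → ℝ) (hS : Measurable S) (a : ℝ) (ha : 0 ≤ a) :
    γ {x | (γ {y | S x ≤ S y}).toReal ≤ a} ≤ ENNReal.ofReal a := by
  have hρ : IsProbabilityMeasure (γ.map S) := Measure.isProbabilityMeasure_map hS.aemeasurable
  let U : Set ℝ := {t | γ.map S (Set.Ici t) ≤ ENNReal.ofReal a}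
  have hU : MeasurableSet U := by
    have : IsUpperSet U := fun s t hst hs =>
      (measure_mono (Set.Ici_subset_Ici.2 hst)).trans hs
    exact this.ordConnected.measurableSet
  have h1 : {x | (γ {y | S x ≤ S y}).toReal ≤ a} = S ⁻¹' U := by
    ext x
    simp only [Set.mem_ofPred_eq, Set.mem_preimage, U]
    rw [Measure.map_apply hS measurableSet_Ici, ENNReal.le_ofReal_iff_toReal_le (measure_ne_top _ _) ha]
    rfl
  rw [h1, ← Measure.map_apply hS hU, hU.measure_eq_iSup_isCompact]
  refine iSup_le fun K => iSup_le fun hK => iSup_le fun hc => ?_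
  rcases K.eq_empty_or_nonempty with rfl | hne
  · simp
  · obtain ⟨t, htK, ht⟩ := hc.exists_isLeast hne
    exact (measure_mono (fun x hx => ht hx)).trans (hK htK)

lemma quantile_spec (b : ℕ) (α0 : ℝ) (hα0 : α0 ∈ Set.Ioo (0 : ℝ) 1) :
    0 ≤ chiSqQuantile b (1 - α0) ∧
      ENNReal.ofReal (1 - α0) ≤ chiSq b (Set.Iic (chiSqQuantile b (1 - α0))) := by
  have hm : Measurable (fun g : Fin b → ℝ => ∑ i, g i ^ 2) := by fun_prop
  have : IsProbabilityMeasure (chiSq b) := Measure.isProbabilityMeasure_map hm.aemeasurable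
  set U : Set ℝ := {x : ℝ | ENNReal.ofReal (1 - α0) ≤ chiSq b (Set.Iic x)} with hU
  have hlow : ∀ x ∈ U, 0 ≤ x := by
    intro x hx
    by_contra hneg
    push Not at hneg
    have : chiSq b (Set.Iic x) = 0 := by
      unfold chiSq
      rw [Measure.map_apply hm measurableSet_Iic]
      have : (fun g : Fin b → ℝ => ∑ i, g i ^ 2) ⁻¹' Set.Iic x = ∅ := by
        ext g
        simp only [Set.mem_preimage, Set.mem_Iic, Set.mem_empty_iff_false, iff_false, not_le]
        exact hneg.trans_le (Finset.sum_nonneg fun i _ => sq_nonneg _)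
      rw [this]; simp
    simp only [hU, Set.mem_ofPred_eq, this, nonpos_iff_eq_zero, ENNReal.ofReal_eq_zero] at hx
    linarith [hα0.2]
  have hne : U.Nonempty := by
    have ht := tendsto_measure_Iic_atTop (chiSq b)
    rw [measure_univ] at ht
    have hlt : ENNReal.ofReal (1 - α0) < 1 := by
      rw [ENNReal.ofReal_lt_one]; linarith [hα0.1]
    obtain ⟨x, hx⟩ := (ht.eventually (lt_mem_nhds hlt)).exists
    exact ⟨x, hx.le⟩
  have hbdd : BddBelow U := ⟨0, hlow⟩
  have hup : ∀ x y, x ∈ U → x ≤ y → y ∈ U := fun x y hx hxy =>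
    le_trans (α := ENNReal) hx (measure_mono (Set.Iic_subset_Iic.2 hxy))
  change 0 ≤ sInf U ∧ ENNReal.ofReal (1 - α0) ≤ chiSq b (Set.Iic (sInf U))
  refine ⟨le_csInf hne hlow, ?_⟩
  have hI : Set.Iic (sInf U) = ⋂ k : ℕ, Set.Iic (sInf U + 1 / ((k:ℝ) + 1)) := by
    ext x
    simp only [Set.mem_Iic, Set.mem_iInter]
    constructor
    · intro h k
      have : (0:ℝ) < 1 / ((k:ℝ) + 1) := by positivity
      linarith
    · intro h
      refine le_of_forall_pos_le_add fun ε hε => ?_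
      obtain ⟨k, hk⟩ := exists_nat_one_div_lt hε
      linarith [h k]
  have hanti : Antitone fun k : ℕ => Set.Iic (sInf U + 1 / ((k:ℝ) + 1)) := by
    intro i j hij
    apply Set.Iic_subset_Iic.2
    gcongr
  rw [hI, hanti.measure_iInter (fun i => measurableSet_Iic.nullMeasurableSet) 
    ⟨0, measure_ne_top _ _⟩]
  refine le_iInf fun k => ?_
  have : (0:ℝ) < 1 / ((k:ℝ) + 1) := by positivity
  obtain ⟨y, hy, hy2⟩ := exists_lt_of_csInf_lt hne (lt_add_of_pos_right (sInf U) this)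
  exact hup y _ hy hy2.le

end PPT
namespace PPT

lemma tail_inner_le {n : ℕ} (b : ℕ) (δ z : Fin n → ℝ) (hδ : ∀ i : Fin n, (i : ℕ) < n - b → δ i = 0) :
    |∑ i, δ i * z i| ≤ √(tailNormSq b δ) * √(tailNormSq b z) := by
  have h1 : ∑ i, δ i * z i =
      ∑ i ∈ Finset.univ.filter (fun i : Fin n => n - b ≤ (i : ℕ)), δ i * z i := by
    rw [Finset.sum_filter]
    refine Finset.sum_congr rfl fun i _ => ?_
    split_ifs with h
    · rfl
    · rw [hδ i (by omega), zero_mul]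
  rw [h1, ← Real.sqrt_mul (by unfold tailNormSq; positivity)]
  apply Real.abs_le_sqrt
  exact Finset.sum_mul_sq_le_sq_mul_sq _ _ _

lemma tail_nonneg {n : ℕ} (b : ℕ) (z : Fin n → ℝ) : 0 ≤ tailNormSq b z := by
  unfold tailNormSq; positivity

lemma tail_add_le {n : ℕ} (b : ℕ) (z δ : Fin n → ℝ) :
    tailNormSq b (z + δ) ≤ (√(tailNormSq b z) + √(tailNormSq b δ)) ^ 2 := by
  have h1 : tailNormSq b (z + δ) = tailNormSq b z + tailNormSq b δ + 2 *
      ∑ i ∈ Finset.univ.filter (fun i : Fin n => n - b ≤ (i : ℕ)), z i * δ i := by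
    unfold tailNormSq
    rw [Finset.mul_sum, ← Finset.sum_add_distrib, ← Finset.sum_add_distrib]
    refine Finset.sum_congr rfl fun i _ => ?_
    simp only [Pi.add_apply]; ring
  have h2 := Real.sum_mul_le_sqrt_mul_sqrt
    (Finset.univ.filter (fun i : Fin n => n - b ≤ (i : ℕ))) z δ
  change _ ≤ √(tailNormSq b z) * √(tailNormSq b δ) at h2
  rw [h1, add_sq, Real.sq_sqrt (tail_nonneg b z), Real.sq_sqrt (tail_nonneg b δ)]
  linarith

lemma measurable_tail {n : ℕ} (b : ℕ) : Measurable (tailNormSq b : (Fin n → ℝ) → ℝ) := by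
  unfold tailNormSq; fun_prop

lemma tail_law {n b : ℕ} (hb2 : b ≤ n) :
    (stdGaussianPi n).map (tailNormSq b) = chiSq b := by
  let e : Fin b → Fin n := fun j => ⟨n - b + j, by omega⟩
  have he : Function.Injective e := by
    intro i j h
    simp only [e, Fin.mk.injEq] at h
    ext; omega
  unfold chiSq
  rw [← map_comp_inj e he, Measure.map_map (by fun_prop) (by fun_prop)]
  congr 1
  ext w
  simp only [Function.comp, tailNormSq]
  symm
  refine Finset.sum_bij (fun j _ => e j) ?_ ?_ ?_ ?_
  · intro j _
    simp only [e, Finset.mem_filter, Finset.mem_univ, true_and]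
    omega
  · intro i _ j _ h; exact he h
  · intro i hi
    simp only [Finset.mem_filter, Finset.mem_univ, true_and] at hi
    exact ⟨⟨i - (n - b), by omega⟩, Finset.mem_univ _, by ext; simp only [e]; omega⟩
  · intro j _; rfl

lemma tail_prob {n b : ℕ} (hb2 : b ≤ n) (α0 : ℝ) (hα0 : α0 ∈ Set.Ioo (0 : ℝ) 1) :
    stdGaussianPi n {g | ¬ tailNormSq b g ≤ chiSqQuantile b (1 - α0)} ≤ ENNReal.ofReal α0 := by
  have h := (quantile_spec b α0 hα0).2
  rw [← tail_law hb2, Measure.map_apply (measurable_tail b) measurableSet_Iic] at h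
  have hs : MeasurableSet (tailNormSq b ⁻¹' Set.Iic (chiSqQuantile b (1 - α0)) :
      Set (Fin n → ℝ)) := measurable_tail b measurableSet_Iic
  change stdGaussianPi n (tailNormSq b ⁻¹' Set.Iic (chiSqQuantile b (1 - α0)))ᶜ ≤ _
  rw [prob_compl_eq_one_sub hs]
  calc _ ≤ 1 - ENNReal.ofReal (1 - α0) := tsub_le_tsub_left h _
    _ = ENNReal.ofReal α0 := by
      rw [← ENNReal.ofReal_one, ← ENNReal.ofReal_sub _ (by linarith [hα0.2])]
      congr 1; ring

lemma assemble {n b : ℕ} (hb2 : b ≤ n) {Ω : Type*} [MeasurableSpace Ω]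
    (γ : Measure Ω) [IsProbabilityMeasure γ] (θ : (Fin n → ℝ) → Ω → (Fin n → ℝ))
    (hθ : Measurable (Function.uncurry θ))
    (hinv : ∀ F : (Fin n → ℝ) → ENNReal, Measurable F →
      ∫⁻ w, ∫⁻ g, F (θ w g) ∂γ ∂stdGaussianPi n = ∫⁻ w, F w ∂stdGaussianPi n)
    (htail : ∀ w, ∀ᵐ g ∂γ, tailNormSq b (θ w g) = tailNormSq b w)
    (htail' : ∀ w g, tailNormSq b (θ w g) ≤ tailNormSq b w)
    (δ : Fin n → ℝ) (hδ : ∀ i : Fin n, (i : ℕ) < n - b → δ i = 0)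
    (q : (Fin n → ℝ) → ℝ) (hqm : Measurable q) (hq0 : ∀ w, 0 ≤ q w)
    (hq : ∀ a, 0 ≤ a → ∀ w, γ {g | q (θ w g) ≤ a} ≤ ENNReal.ofReal a)
    (α0 : ℝ) (hα0 : α0 ∈ Set.Ioo (0 : ℝ) 1) (ω : ℝ) (hω : ω = tailNormSq b δ) (v : ℝ)
    (hv : v = (1 / 2) * Real.exp
        (2 * Real.sqrt (2 * ω) * Real.sqrt (chiSqQuantile b (1 - α0) + ω)) - 1 / 2)
    (α : ℝ) :
    stdGaussianPi n {g | q (g + δ) + v + α0 ≤ α} ≤ ENNReal.ofReal α := by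
  obtain ⟨hQ0, -⟩ := quantile_spec b α0 hα0
  have htp := tail_prob hb2 α0 hα0
  set Q := chiSqQuantile b (1 - α0) with hQ
  have hω0 : 0 ≤ ω := hω ▸ tail_nonneg b δ
  set E := 2 * √(2 * ω) * √(Q + ω) with hE
  have hE0 : 0 ≤ E := by positivity
  have hv0 : 0 ≤ v := by
    have := Real.one_le_exp hE0
    rw [hv]; linarith
  by_cases ha : α - v - α0 < 0
  · have : {g : Fin n → ℝ | q (g + δ) + v + α0 ≤ α} = ∅ := by
      ext g
      simp only [Set.mem_ofPred_eq, Set.mem_empty_iff_false, iff_false, not_le]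
      linarith [hq0 (g + δ)]
    rw [this]; simp
  push Not at ha
  set a := α - v - α0 with haa
  set A : Set (Fin n → ℝ) := {z | q z ≤ a} with hA
  set B : Set (Fin n → ℝ) := {z | tailNormSq b z ≤ (√Q + √ω) ^ 2} with hB
  have hAm : MeasurableSet A := measurableSet_le hqm measurable_const
  have hBm : MeasurableSet B := measurableSet_le (measurable_tail b) measurable_const
  let L : (Fin n → ℝ) → ℝ := fun x => Real.exp (∑ i, δ i * x i - (∑ i, δ i ^ 2) / 2)
  have hLm : Measurable L := by simp only [L]; fun_prop
  have hEE : 2 * √ω * (√Q + √ω) ≤ E := by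
    have h1 : √Q + √ω ≤ √2 * √(Q + ω) := by
      rw [← Real.sqrt_mul (by norm_num)]
      apply Real.le_sqrt_of_sq_le
      nlinarith [sq_nonneg (√Q - √ω), Real.sq_sqrt hQ0, Real.sq_sqrt hω0]
    rw [hE, Real.sqrt_mul (by norm_num)]
    calc 2 * √ω * (√Q + √ω) ≤ 2 * √ω * (√2 * √(Q + ω)) := by gcongr
      _ = _ := by ring
  have hrat : ∀ w ∈ B, ∀ g g', L (θ w g) ≤ Real.exp E * L (θ w g') := by
    intro w hw g g'
    have hb : ∀ g, |∑ i, δ i * θ w g i| ≤ √ω * (√Q + √ω) := by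
      intro g
      refine (tail_inner_le b δ _ hδ).trans ?_
      rw [← hω]
      gcongr
      exact Real.sqrt_le_iff.2 ⟨by positivity, (htail' w g).trans hw⟩
    simp only [L]
    rw [← Real.exp_add]
    apply Real.exp_le_exp.2
    have h1 := (abs_le.1 (hb g)).2
    have h2 := (abs_le.1 (hb g')).1
    linarith
  have hcore := core (stdGaussianPi n) γ θ hθ hinv A B hAm hBm a ha (fun w => hq a ha w) L hLm
    (fun w => Real.exp_pos _) E hE0
    (fun w => by
      filter_upwards [htail w] with g hg
      simp only [hB, Set.mem_ofPred_eq, hg]) hrat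
  have hshift : (stdGaussianPi n).map (fun g => g + δ) =
      (stdGaussianPi n).withDensity (fun x => ENNReal.ofReal (L x)) := pi_gauss_shift δ
  rw [← withDensity_apply _ (hAm.inter hBm), ← withDensity_apply _ hBm, ← hshift, ← hv] at hcore
  have hsm : Measurable (fun g : Fin n → ℝ => g + δ) := by fun_prop
  have hpB : (stdGaussianPi n).map (fun g => g + δ) B ≤ 1 := by
    have := Measure.isProbabilityMeasure_map (μ := stdGaussianPi n) hsm.aemeasurable
    exact prob_le_one
  have h1 : (stdGaussianPi n).map (fun g => g + δ) (A ∩ B) ≤ ENNReal.ofReal (a + v) :=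
    hcore.trans (mul_le_of_le_one_right' hpB)
  rw [Measure.map_apply hsm (hAm.inter hBm)] at h1
  have hsub : {g : Fin n → ℝ | q (g + δ) + v + α0 ≤ α} ⊆
      ((fun g => g + δ) ⁻¹' (A ∩ B)) ∪ {g | ¬ tailNormSq b g ≤ Q} := by
    intro g hg
    by_cases hg2 : tailNormSq b g ≤ Q
    · left
      refine ⟨?_, ?_⟩
      · simp only [Set.mem_ofPred_eq] at hg
        simp only [hA, Set.mem_ofPred_eq]
        linarith
      · change tailNormSq b (g + δ) ≤ (√Q + √ω) ^ 2
        refine (tail_add_le b g δ).trans ?_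
        rw [← hω]
        gcongr
    · right; exact hg2
  calc _ ≤ _ := measure_mono hsub
    _ ≤ _ := measure_union_le _ _
    _ ≤ ENNReal.ofReal (a + v) + ENNReal.ofReal α0 := add_le_add h1 htp
    _ = ENNReal.ofReal α := by
      rw [← ENNReal.ofReal_add (by linarith) hα0.1.le]
      congr 1; rw [haa]; ring

lemma measurable_wStar {n : ℕ} (b : ℕ) :
    Measurable (Function.uncurry (wStar b : (Fin n → ℝ) → (Fin n → ℝ) → (Fin n → ℝ))) := by
  refine measurable_pi_lambda _ fun i => ?_
  have h1 := (measurable_tail (n := n) b)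
  simp only [Function.uncurry, wStar]
  split_ifs
  · fun_prop
  · exact ((Measurable.sqrt (h1.comp measurable_fst)).mul (by fun_prop)).div
      (Measurable.sqrt (h1.comp measurable_snd))

lemma tail_wStar {n : ℕ} (b : ℕ) (w g : Fin n → ℝ) :
    tailNormSq b (wStar b w g) = tailNormSq b w * (tailNormSq b g / tailNormSq b g) := by
  have h : tailNormSq b (wStar b w g) = ∑ i ∈ Finset.univ.filter (fun i : Fin n => n - b ≤ (i : ℕ)),
      tailNormSq b w / tailNormSq b g * g i ^ 2 := by
    conv_lhs => unfold tailNormSq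
    refine Finset.sum_congr rfl fun i hi => ?_
    simp only [Finset.mem_filter, Finset.mem_univ, true_and] at hi
    simp only [wStar]
    rw [if_neg (by omega), div_pow, mul_pow, Real.sq_sqrt (tail_nonneg b w),
      Real.sq_sqrt (tail_nonneg b g)]
    ring
  rw [h, ← Finset.mul_sum]
  change tailNormSq b w / tailNormSq b g * tailNormSq b g = _
  ring

lemma tail_ne_zero {n b : ℕ} (hb1 : 1 ≤ b) (hb2 : b ≤ n) :
    ∀ᵐ g ∂stdGaussianPi n, tailNormSq b g ≠ 0 := by
  let i : Fin n := ⟨n - 1, by omega⟩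
  have h1 : ∀ᵐ x ∂gaussianReal 0 1, x ≠ 0 := by
    have := nullSingletonClass_gaussianReal (μ := 0) (v := 1) one_ne_zero
    exact Measure.ae_ne _ _
  have h2 := (measurePreserving_eval (fun _ : Fin n => gaussianReal 0 1) i).quasiMeasurePreserving.ae h1
  filter_upwards [h2] with g hg
  have : 0 < tailNormSq b g := by
    unfold tailNormSq
    refine Finset.sum_pos' (fun _ _ => sq_nonneg _) ⟨i, ?_, ?_⟩
    · simp [i]; omega
    · have : g i ≠ 0 := hg
      positivity
  exact this.ne'

lemma wStar_wStar {n : ℕ} (b : ℕ) (w g g' : Fin n → ℝ) (hg : tailNormSq b g ≠ 0) :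
    wStar b (wStar b w g) g' = wStar b w g' := by
  have ht : tailNormSq b (wStar b w g) = tailNormSq b w := by
    rw [tail_wStar, div_self hg, mul_one]
  ext i
  by_cases h : (i : ℕ) < n - b
  · have h1 : ∀ u u' : Fin n → ℝ, wStar b u u' i = u i := fun u u' => if_pos h
    rw [h1, h1, h1]
  · have h1 : ∀ u u' : Fin n → ℝ, wStar b u u' i =
      Real.sqrt (tailNormSq b u) * u' i / Real.sqrt (tailNormSq b u') := fun u u' => if_neg h
    rw [h1, h1, ht]

lemma star_rank {V Ω : Type*} [MeasurableSpace Ω] (γ : Measure Ω) [IsProbabilityMeasure γ]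
    (θ : V → Ω → V) (S : V → ℝ) (w : V) (hS : Measurable fun g => S (θ w g))
    (hθ : ∀ᵐ g ∂γ, ∀ g', θ (θ w g) g' = θ w g') (a : ℝ) (ha : 0 ≤ a) :
    γ {g | (γ {g' | S (θ w g) ≤ S (θ (θ w g) g')}).toReal ≤ a} ≤ ENNReal.ofReal a := by
  refine le_trans (measure_mono_ae ?_) (rank_valid γ (fun g => S (θ w g)) hS a ha)
  refine hθ.mono fun g hg h => ?_
  have h3 : (γ {g' | S (θ w g) ≤ S (θ (θ w g) g')}).toReal ≤ a := h
  simp only [hg] at h3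
  exact h3

lemma star_meas {V Ω : Type*} [MeasurableSpace Ω] [MeasurableSpace V]
    (θ : V → Ω → V) (hθ : Measurable (Function.uncurry θ)) (S : V → ℝ) (hS : Measurable S)
    (w : V) : Measurable fun g => S (θ w g) :=
  hS.comp (hθ.comp measurable_prodMk_left)

lemma cont_valid {n b : ℕ} (hb1 : 1 ≤ b) (hb2 : b ≤ n) (S : (Fin n → ℝ) → ℝ) (hS : Measurable S)
    (δ : Fin n → ℝ) (hδ : ∀ i : Fin n, (i : ℕ) < n - b → δ i = 0)
    (α0 : ℝ) (hα0 : α0 ∈ Set.Ioo (0 : ℝ) 1) (ω : ℝ) (hω : ω = tailNormSq b δ) (v : ℝ)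
    (hv : v = (1 / 2) * Real.exp
        (2 * Real.sqrt (2 * ω) * Real.sqrt (chiSqQuantile b (1 - α0) + ω)) - 1 / 2)
    (α : ℝ) :
    stdGaussianPi n {z | (stdGaussianPi n {g | S (z + δ) ≤ S (wStar b (z + δ) g)}).toReal
      + v + α0 ≤ α} ≤ ENNReal.ofReal α := by
  refine assemble hb2 (stdGaussianPi n) (wStar b) (measurable_wStar b)
    (fun F hF => wStar_inv hb1 hb2 F hF) ?_ ?_ δ hδ
    (fun z => (stdGaussianPi n {g | S z ≤ S (wStar b z g)}).toReal) ?_ 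
    (fun _ => ENNReal.toReal_nonneg) ?_ α0 hα0 ω hω v hv α
  · intro w
    filter_upwards [tail_ne_zero hb1 hb2] with g hg
    rw [tail_wStar, div_self hg, mul_one]
  · intro w g
    rw [tail_wStar]
    exact mul_le_of_le_one_right (tail_nonneg b w) (div_self_le_one _)
  · apply Measurable.ennreal_toReal
    have : MeasurableSet {p : (Fin n → ℝ) × (Fin n → ℝ) | S p.1 ≤ S (wStar b p.1 p.2)} :=
      measurableSet_le (hS.comp measurable_fst) (hS.comp (measurable_wStar b))
    exact measurable_measure_prodMk_left this
  · intro a ha w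
    have hw : Measurable (fun g => S (wStar b w g)) :=
      star_meas (wStar b) (measurable_wStar b) S hS w
    refine star_rank (stdGaussianPi n) (wStar b) S w hw ?_ a ha
    exact (tail_ne_zero hb1 hb2).mono fun g hg g' => wStar_wStar b w g g' hg

end PPT
namespace PPT

lemma one_mem_permSet (n b : ℕ) : (1 : Equiv.Perm (Fin n)) ∈ permSet n b := by
  simp [permSet]

lemma mem_permSet {n b : ℕ} {ψ : Equiv.Perm (Fin n)} :
    ψ ∈ permSet n b ↔ ∀ i : Fin n, (i : ℕ) < n - b → ψ i = i := by
  simp [permSet]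

lemma inv_mem_permSet {n b : ℕ} {ψ : Equiv.Perm (Fin n)} (h : ψ ∈ permSet n b) :
    ψ⁻¹ ∈ permSet n b := by
  rw [mem_permSet] at h ⊢
  intro i hi
  rw [Equiv.Perm.inv_eq_iff_eq, h i hi]

lemma mul_mem_permSet {n b : ℕ} {ψ φ : Equiv.Perm (Fin n)} (h : ψ ∈ permSet n b)
    (h' : φ ∈ permSet n b) : ψ * φ ∈ permSet n b := by
  rw [mem_permSet] at h h' ⊢
  intro i hi
  rw [Equiv.Perm.mul_apply, h' i hi, h i hi]

lemma permSet_tail {n b : ℕ} {ψ : Equiv.Perm (Fin n)} (h : ψ ∈ permSet n b) (i : Fin n)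
    (hi : ¬ (i : ℕ) < n - b) : ¬ (ψ i : ℕ) < n - b := by
  intro h2
  have := mem_permSet.1 h (ψ i) h2
  exact hi (by rw [← ψ.injective this]; exact h2)

lemma tail_perm {n b : ℕ} {ψ : Equiv.Perm (Fin n)} (h : ψ ∈ permSet n b) (w : Fin n → ℝ) :
    tailNormSq b (w ∘ ψ) = tailNormSq b w := by
  unfold tailNormSq
  refine Finset.sum_bij (fun i _ => ψ i) ?_ ?_ ?_ ?_
  · intro i hi
    simp only [Finset.mem_filter, Finset.mem_univ, true_and] at hi ⊢
    have := permSet_tail h i (by omega)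
    omega
  · intro i _ j _ hij; exact ψ.injective hij
  · intro i hi
    simp only [Finset.mem_filter, Finset.mem_univ, true_and] at hi
    have := permSet_tail (inv_mem_permSet h) i (by omega)
    refine ⟨ψ⁻¹ i, ?_, by simp⟩
    simp only [Finset.mem_filter, Finset.mem_univ, true_and]
    omega
  · intro i _; rfl

instance permMS (n b : ℕ) : MeasurableSpace (permSet n b) := ⊤

instance permMSC (n b : ℕ) : MeasurableSingletonClass (permSet n b) := ⟨fun _ => trivial⟩

instance permNE (n b : ℕ) : Nonempty (permSet n b) := ⟨⟨1, one_mem_permSet n b⟩⟩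

/-- uniform measure on `permSet`. -/
def permLaw (n b : ℕ) : Measure (permSet n b) :=
  ((permSet n b).card : ENNReal)⁻¹ • Measure.count

lemma card_ne (n b : ℕ) : (permSet n b).card ≠ 0 :=
  Finset.card_ne_zero_of_mem (one_mem_permSet n b)

lemma permLaw_lintegral (n b : ℕ) (f : permSet n b → ENNReal) :
    ∫⁻ ψ, f ψ ∂permLaw n b = ((permSet n b).card : ENNReal)⁻¹ * ∑ ψ, f ψ := by
  unfold permLaw
  rw [lintegral_smul_measure, lintegral_count, tsum_fintype, smul_eq_mul]

instance permLawProb (n b : ℕ) : IsProbabilityMeasure (permLaw n b) := by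
  constructor
  rw [← lintegral_one, permLaw_lintegral]
  simp only [Finset.sum_const, Finset.card_univ, Fintype.card_coe, nsmul_eq_mul, mul_one]
  exact ENNReal.inv_mul_cancel (by exact_mod_cast card_ne n b) (by simp)

lemma permLaw_toReal (n b : ℕ) (P : Equiv.Perm (Fin n) → Prop) [DecidablePred P] :
    (permLaw n b {ψ | P ψ}).toReal =
      ((permSet n b).card : ℝ)⁻¹ * ∑ ψ ∈ permSet n b, if P ψ then 1 else 0 := by
  have hs : MeasurableSet {ψ : permSet n b | P ψ} := trivial
  rw [← lintegral_indicator_one hs, permLaw_lintegral, ENNReal.toReal_mul, ENNReal.toReal_inv,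
    ENNReal.toReal_natCast, ENNReal.toReal_sum, ← Finset.sum_coe_sort (permSet n b)]
  · congr 1
    refine Finset.sum_congr rfl fun ψ _ => ?_
    by_cases h : P ψ
    · rw [Set.indicator_of_mem (s := {ψ : permSet n b | P ψ}) h, if_pos h]; simp
    · rw [Set.indicator_of_notMem (s := {ψ : permSet n b | P ψ}) h, if_neg h]; simp
  · intro ψ _
    by_cases h : P ψ
    · rw [Set.indicator_of_mem (s := {ψ : permSet n b | P ψ}) h]; simp
    · rw [Set.indicator_of_notMem (s := {ψ : permSet n b | P ψ}) h]; simp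

/-- Normalised discrete p-value. -/
def pD {n : ℕ} (b : ℕ) (S : (Fin n → ℝ) → ℝ) (z : Fin n → ℝ) : ℝ :=
  ((permSet n b).card : ℝ)⁻¹ * ∑ ψ ∈ permSet n b, if S z ≤ S (z ∘ ψ) then 1 else 0

lemma pD_perm {n b : ℕ} (S : (Fin n → ℝ) → ℝ) (w : Fin n → ℝ) {ψ : Equiv.Perm (Fin n)}
    (h : ψ ∈ permSet n b) : pD b S (w ∘ ψ) =
      ((permSet n b).card : ℝ)⁻¹ * ∑ φ ∈ permSet n b, if S (w ∘ ψ) ≤ S (w ∘ φ) then 1 else 0 := by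
  unfold pD
  congr 1
  refine Finset.sum_bij (fun φ _ => ψ * φ) ?_ ?_ ?_ ?_
  · intro φ hφ; exact mul_mem_permSet h hφ
  · intro φ _ φ' _ hh; exact mul_left_cancel hh
  · intro φ hφ
    exact ⟨ψ⁻¹ * φ, mul_mem_permSet (inv_mem_permSet h) hφ, by simp⟩
  · intro φ _; rfl

lemma measurable_pD {n : ℕ} (b : ℕ) (S : (Fin n → ℝ) → ℝ) (hS : Measurable S) :
    Measurable (pD b S) := by
  have hc : ∀ ψ : Equiv.Perm (Fin n), Measurable (fun w : Fin n → ℝ => w ∘ ψ) := by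
    intro ψ
    exact measurable_pi_lambda _ fun i => measurable_pi_apply _
  unfold pD
  refine Measurable.const_mul ?_ _
  refine Finset.measurable_fun_sum _ fun ψ _ => ?_
  exact Measurable.ite (measurableSet_le hS (hS.comp (hc ψ))) measurable_const measurable_const

lemma measurable_pC {n : ℕ} (b : ℕ) (S : (Fin n → ℝ) → ℝ) (hS : Measurable S) :
    Measurable (fun z => (stdGaussianPi n {g | S z ≤ S (wStar b z g)}).toReal) := by
  apply Measurable.ennreal_toReal
  have : MeasurableSet {p : (Fin n → ℝ) × (Fin n → ℝ) | S p.1 ≤ S (wStar b p.1 p.2)} :=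
    measurableSet_le (hS.comp measurable_fst) (hS.comp (measurable_wStar b))
  exact measurable_measure_prodMk_left this

lemma whiten {n : ℕ} (R Sh : Fin n → Fin n → ℝ) (h : mulF R Sh = idF n) (f : Fin n → ℝ) (σ : ℝ)
    (g : Fin n → ℝ) : mulVecF R (fun i => f i + σ * mulVecF Sh g i) =
      fun i => mulVecF R f i + σ * g i := by
  have h1 : ∀ i k, ∑ j, R i j * Sh j k = if i = k then 1 else 0 :=
    fun i k => congrFun (congrFun h i) k
  ext i
  simp only [mulVecF, mul_add, Finset.sum_add_distrib]
  congr 1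
  have : ∑ j, R i j * (σ * ∑ k, Sh j k * g k) = σ * ∑ k, (∑ j, R i j * Sh j k) * g k := by
    simp only [Finset.mul_sum, Finset.sum_mul]
    rw [Finset.sum_comm]
    refine Finset.sum_congr rfl fun k _ => Finset.sum_congr rfl fun j _ => ?_
    ring
  rw [this]
  simp [h1]

lemma orth_cancel {n : ℕ} (Γ : Fin n → Fin n → ℝ) (hΓ : IsOrthogonalF Γ) (y : Fin n → ℝ) :
    mulVecF Γ (tmulVecF Γ y) = y := by
  ext i
  have : mulVecF Γ (tmulVecF Γ y) i = ∑ k, (∑ j, Γ i j * Γ k j) * y k := by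
    simp only [mulVecF, tmulVecF, Finset.mul_sum, Finset.sum_mul]
    rw [Finset.sum_comm]
    refine Finset.sum_congr rfl fun k _ => Finset.sum_congr rfl fun j _ => ?_
    ring
  rw [this]
  simp [hΓ i]

lemma emb_perm {n b : ℕ} (mh : Fin n → ℝ) (σ : ℝ) (h0 : ∀ i : Fin n, ¬ (i : ℕ) < n - b → mh i = 0)
    {ψ : Equiv.Perm (Fin n)} (h : ψ ∈ permSet n b) (z : Fin n → ℝ) :
    (fun i => mh i + σ * z i) ∘ ψ = fun i => mh i + σ * (z ∘ ψ) i := by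
  ext i
  simp only [Function.comp]
  by_cases hi : (i : ℕ) < n - b
  · rw [mem_permSet.1 h i hi]
  · rw [h0 i hi, h0 _ (permSet_tail h i hi)]

lemma emb_wStar {n b : ℕ} (mh : Fin n → ℝ) (σ : ℝ) (hσ : 0 < σ)
    (h0 : ∀ i : Fin n, ¬ (i : ℕ) < n - b → mh i = 0) (z g : Fin n → ℝ) :
    wStar b (fun i => mh i + σ * z i) g = fun i => mh i + σ * wStar b z g i := by
  have ht : tailNormSq b (fun i => mh i + σ * z i) = σ ^ 2 * tailNormSq b z := by
    unfold tailNormSq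
    rw [Finset.mul_sum]
    refine Finset.sum_congr rfl fun i hi => ?_
    simp only [Finset.mem_filter, Finset.mem_univ, true_and] at hi
    show (mh i + σ * z i) ^ 2 = σ ^ 2 * z i ^ 2
    rw [h0 i (by omega)]; ring
  ext i
  by_cases h : (i : ℕ) < n - b
  · have h1 : ∀ u u' : Fin n → ℝ, wStar b u u' i = u i := fun u u' => if_pos h
    rw [h1, h1]
  · have h1 : ∀ u u' : Fin n → ℝ, wStar b u u' i =
      Real.sqrt (tailNormSq b u) * u' i / Real.sqrt (tailNormSq b u') := fun u u' => if_neg h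
    rw [h1, h1, ht, Real.sqrt_mul (sq_nonneg _), Real.sqrt_sq hσ.le, h0 i h]
    ring

lemma disc_valid {n b : ℕ} (hb2 : b ≤ n) (S : (Fin n → ℝ) → ℝ) (hS : Measurable S)
    (δ : Fin n → ℝ) (hδ : ∀ i : Fin n, (i : ℕ) < n - b → δ i = 0)
    (α0 : ℝ) (hα0 : α0 ∈ Set.Ioo (0 : ℝ) 1) (ω : ℝ) (hω : ω = tailNormSq b δ) (v : ℝ)
    (hv : v = (1 / 2) * Real.exp
        (2 * Real.sqrt (2 * ω) * Real.sqrt (chiSqQuantile b (1 - α0) + ω)) - 1 / 2)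
    (α : ℝ) :
    stdGaussianPi n {z | pD b S (z + δ) + v + α0 ≤ α} ≤ ENNReal.ofReal α := by
  have hc : ∀ ψ : Equiv.Perm (Fin n), Measurable (fun w : Fin n → ℝ => w ∘ ψ) := by
    intro ψ
    exact measurable_pi_lambda _ fun i => measurable_pi_apply _
  refine assemble hb2 (permLaw n b) (fun w ψ => w ∘ ψ.1) ?_ ?_ ?_ ?_ δ hδ
    (pD b S) ?_ ?_ ?_ α0 hα0 ω hω v hv α
  · exact measurable_from_prod_countable_left fun ψ => hc ψ.1
  · intro F hF
    simp_rw [permLaw_lintegral]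
    rw [lintegral_const_mul, lintegral_finsetSum]
    · have : ∀ ψ : permSet n b, ∫⁻ w, F (w ∘ ψ.1) ∂stdGaussianPi n = ∫⁻ w, F w ∂stdGaussianPi n := by
        intro ψ
        conv_rhs => rw [← map_comp_inj ψ.1 ψ.1.injective]
        rw [lintegral_map hF (hc ψ.1)]
      simp_rw [this]
      simp only [Finset.sum_const, Finset.card_univ, Fintype.card_coe, nsmul_eq_mul]
      rw [← mul_assoc, ENNReal.inv_mul_cancel (by exact_mod_cast card_ne n b) (by simp), one_mul]
    · intro ψ _; exact hF.comp (hc ψ.1)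
    · exact Finset.measurable_fun_sum _ fun ψ _ => hF.comp (hc ψ.1)
  · intro w
    exact ae_of_all _ fun ψ => tail_perm ψ.2 w
  · intro w ψ
    exact (tail_perm ψ.2 w).le
  · unfold pD
    refine Measurable.const_mul ?_ _
    refine Finset.measurable_fun_sum _ fun ψ _ => ?_
    exact Measurable.ite (measurableSet_le hS (hS.comp (hc ψ))) measurable_const measurable_const
  · intro w
    unfold pD
    refine mul_nonneg (by positivity) (Finset.sum_nonneg fun ψ _ => ?_)
    split_ifs <;> norm_num
  · intro a ha w
    refine le_trans (measure_mono ?_) (rank_valid (permLaw n b) (fun ψ => S (w ∘ ψ.1))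
      (fun _ _ => trivial) a ha)
    intro ψ hψ
    have h3 : pD b S (w ∘ ψ.1) ≤ a := hψ
    rw [pD_perm S w ψ.2, ← permLaw_toReal n b (fun φ => S (w ∘ ψ.1) ≤ S (w ∘ φ))] at h3
    exact h3

end PPT
open PPT in
/-- Theorem 6, `thm:fixed_property_theorem_corr`: validity of the corrected
partial permutation p-value in the presence of correlated Gaussian noise `ε ~ N(0, σ₀² Σ)`,
where the test is applied to `Y^C = Σ^{-1/2} Y` with kernel matrix
`Kₙ^C = Σ^{-1/2} Kₙ Σ^{-1/2}`, with correction built from the left-over signal proportion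
`ω_C(b, σ₀⁻¹f₀, Σ)` and the chi-squared quantile `Q_b(1-α₀)`. -/
theorem partial_permutation_valid_corrected_correlated
    {n d H : ℕ} (hn : 1 ≤ n)
    (X : Fin n → Fin d → ℝ) (Z : Fin n → Fin H)
    -- the true functional relationship, an arbitrary measurable function
    (f0 : (Fin d → ℝ) → ℝ) (hf0 : Measurable f0)
    -- noise level
    (σ0 : ℝ) (hσ0 : 0 < σ0)
    -- known positive definite covariance structure Σ, with square root Sh = Σ^{1/2} and
    -- inverse square root R = Σ^{-1/2}
    (Sig Sh R : Fin n → Fin n → ℝ)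
    (hSig : IsPosDefF Sig) (hSqrt : IsSqrtPair Sig Sh R)
    -- the law of Y = f0(X) + ε with ε ~ N(0, σ₀² Σ), realized as ε = σ₀ Σ^{1/2} g
    (μY : Measure (Fin n → ℝ))
    (hμY : μY = Measure.map
      (fun g : Fin n → ℝ => fun i => f0 (X i) + σ0 * mulVecF Sh g i) (stdGaussianPi n))
    -- a symmetric positive semidefinite kernel, its sample kernel matrix, and the transformed
    -- kernel matrix Kₙ^C = Σ^{-1/2} Kₙ Σ^{-1/2}
    (K : (Fin d → ℝ) → (Fin d → ℝ) → ℝ) (hK : IsPSDKernel K)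
    (Kn KnC : Fin n → Fin n → ℝ) (hKn : ∀ i j, Kn i j = K (X i) (X j))
    (hKnC : KnC = mulF R (mulF Kn R))
    -- a fixed eigendecomposition Kₙ^C = Γ diag(c) Γᵀ
    (Γ : Fin n → Fin n → ℝ) (c : Fin n → ℝ) (hEig : IsEigenDecomp KnC Γ c)
    -- permutation size
    (b : ℕ) (hb1 : 1 ≤ b) (hb2 : b ≤ n)
    -- arbitrary (measurable) test statistic
    (T : (Fin n → Fin d → ℝ) → (Fin n → ℝ) → (Fin n → Fin H) → ℝ)
    (hT : Measurable fun y => T X y Z)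
    -- correction level α₀
    (α0 : ℝ) (hα0 : α0 ∈ Set.Ioo (0 : ℝ) 1)
    -- left-over signal proportion ω_C(b, σ₀⁻¹ f₀, Σ)
    (ω : ℝ)
    (hω : ω = (σ0 ^ 2)⁻¹ *
      ∑ i ∈ Finset.univ.filter (fun i : Fin n => n - b ≤ (i : ℕ)),
        (tmulVecF Γ (mulVecF R fun j => f0 (X j)) i) ^ 2)
    -- correction term v_C(b, σ₀⁻¹ f₀, Σ, α₀)
    (v : ℝ)
    (hv : v = (1 / 2) * Real.exp
        (2 * Real.sqrt (2 * ω) * Real.sqrt (chiSqQuantile b (1 - α0) + ω)) - 1 / 2) :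
    -- validity of the corrected p-values, computed from Y^C = Σ^{-1/2} Y
    ∀ α ∈ Set.Ioo (0 : ℝ) 1,
      μY {y | pDisc X Z T Γ b (mulVecF R y) + v + α0 ≤ α} ≤ ENNReal.ofReal α ∧
      μY {y | pCont X Z T Γ b (mulVecF R y) + v + α0 ≤ α} ≤ ENNReal.ofReal α := by
  intro α _
  obtain ⟨-, -, hRS, -⟩ := hSqrt
  have hΓ : IsOrthogonalF Γ := hEig.1
  -- the mean of the rotated, whitened response
  set m : Fin n → ℝ := tmulVecF Γ (mulVecF R fun j => f0 (X j)) with hm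
  set mh : Fin n → ℝ := fun i => if (i : ℕ) < n - b then m i else 0 with hmh
  set δ : Fin n → ℝ := fun i => if (i : ℕ) < n - b then 0 else σ0⁻¹ * m i with hδdef
  have hδ : ∀ i : Fin n, (i : ℕ) < n - b → δ i = 0 := fun i hi => if_pos hi
  have hmδ : ∀ i, mh i + σ0 * δ i = m i := by
    intro i
    simp only [hmh, hδdef]
    split_ifs
    · ring
    · field_simp; ring
  have hωδ : ω = tailNormSq b δ := by
    rw [hω, Finset.mul_sum]
    unfold tailNormSq
    refine Finset.sum_congr rfl fun i hi => ?_
    simp only [Finset.mem_filter, Finset.mem_univ, true_and] at hi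
    simp only [hδdef]
    rw [if_neg (by omega), mul_pow, inv_pow]
  let emb : (Fin n → ℝ) → (Fin n → ℝ) := fun z i => mh i + σ0 * z i
  let S : (Fin n → ℝ) → ℝ := fun z => T X (mulVecF Γ (emb z)) Z
  have hmul : ∀ A : Fin n → Fin n → ℝ, Measurable (mulVecF A) := by
    intro A; unfold mulVecF; fun_prop
  have htmul : ∀ A : Fin n → Fin n → ℝ, Measurable (tmulVecF A) := by
    intro A; unfold tmulVecF; fun_prop
  have hS : Measurable S := by
    refine hT.comp ((hmul Γ).comp ?_)
    simp only [emb]; fun_prop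
  have hWh : ∀ g : Fin n → ℝ,
      mulVecF R (fun i => f0 (X i) + σ0 * mulVecF Sh g i) =
        fun i => mulVecF R (fun j => f0 (X j)) i + σ0 * g i :=
    fun g => whiten R Sh hRS _ σ0 g
  have hW : ∀ g : Fin n → ℝ,
      tmulVecF Γ (mulVecF R (fun i => f0 (X i) + σ0 * mulVecF Sh g i)) =
        emb (tmulVecF Γ g + δ) := by
    intro g
    rw [hWh]
    ext i
    have e1 : emb (tmulVecF Γ g + δ) i = m i + σ0 * tmulVecF Γ g i := by
      simp only [emb, Pi.add_apply]
      rw [← hmδ i]; ring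
    rw [e1, hm]
    simp only [tmulVecF, mul_add, Finset.sum_add_distrib, Finset.mul_sum]
    congr 1
    refine Finset.sum_congr rfl fun j _ => ?_
    ring
  have hΓΓ : ∀ y : Fin n → ℝ, mulVecF Γ (tmulVecF Γ y) = y := fun y => orth_cancel Γ hΓ y
  have hY : ∀ g : Fin n → ℝ,
      T X (mulVecF R (fun i => f0 (X i) + σ0 * mulVecF Sh g i)) Z = S (tmulVecF Γ g + δ) := by
    intro g
    simp only [S]
    rw [← hW, hΓΓ]
  have hpD : ∀ g : Fin n → ℝ,
      pDisc X Z T Γ b (mulVecF R (fun i => f0 (X i) + σ0 * mulVecF Sh g i)) =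
        pD b S (tmulVecF Γ g + δ) := by
    intro g
    unfold pDisc pD
    rw [hY, hW]
    congr 1
    refine Finset.sum_congr rfl fun ψ hψ => ?_
    have : emb (tmulVecF Γ g + δ) ∘ ψ = emb ((tmulVecF Γ g + δ) ∘ ψ) :=
      emb_perm mh σ0 (fun i hi => if_neg hi) hψ _
    rw [this]
  have hpC : ∀ g : Fin n → ℝ,
      pCont X Z T Γ b (mulVecF R (fun i => f0 (X i) + σ0 * mulVecF Sh g i)) =
        (stdGaussianPi n {g' | S (tmulVecF Γ g + δ) ≤
          S (wStar b (tmulVecF Γ g + δ) g')}).toReal := by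
    intro g
    unfold pCont
    rw [hY, hW]
    have : ∀ g', wStar b (emb (tmulVecF Γ g + δ)) g' = emb (wStar b (tmulVecF Γ g + δ) g') :=
      fun g' => emb_wStar mh σ0 hσ0 (fun i hi => if_neg hi) _ g'
    simp_rw [this]
    rfl
  have hφ : Measurable (fun g : Fin n → ℝ => fun i => f0 (X i) + σ0 * mulVecF Sh g i) := by
    have := hmul Sh
    fun_prop
  -- measurability of the p-values as functions of `y`, via `y ↦ z`
  have hfun : ∀ (P : (Fin n → ℝ) → ℝ) (q : (Fin n → ℝ) → ℝ),
      (∀ g, P (mulVecF R (fun i => f0 (X i) + σ0 * mulVecF Sh g i)) = q (tmulVecF Γ g + δ)) →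
      Measurable q →
      stdGaussianPi n {z | q (z + δ) + v + α0 ≤ α} ≤ ENNReal.ofReal α →
      (∃ r : (Fin n → ℝ) → (Fin n → ℝ), Measurable r ∧ ∀ y, P (mulVecF R y) = q (r y)) →
      μY {y | P (mulVecF R y) + v + α0 ≤ α} ≤ ENNReal.ofReal α := by
    rintro P q hPq hq hle ⟨r, hr, hPr⟩
    have hset : MeasurableSet {y | P (mulVecF R y) + v + α0 ≤ α} := by
      simp_rw [hPr]
      exact measurableSet_le (((hq.comp hr).add_const _).add_const _) measurable_const
    rw [hμY, Measure.map_apply hφ hset]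
    have hset2 : MeasurableSet {z : Fin n → ℝ | q (z + δ) + v + α0 ≤ α} := by
      refine measurableSet_le ((Measurable.add_const ?_ _).add_const _) measurable_const
      exact hq.comp (by fun_prop)
    rw [← rotate Γ hΓ, Measure.map_apply (htmul Γ) hset2] at hle
    refine le_trans (measure_mono ?_) hle
    intro g hg
    have hg' : P (mulVecF R (fun i => f0 (X i) + σ0 * mulVecF Sh g i)) + v + α0 ≤ α := hg
    rw [hPq] at hg'
    exact hg'
  -- every `y` is of the form `f0(X) + σ0 Σ^{1/2} g`
  have hr : ∃ r : (Fin n → ℝ) → (Fin n → ℝ), Measurable r ∧ ∀ y : Fin n → ℝ, ∃ g : Fin n → ℝ,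
      mulVecF R y = mulVecF R (fun i => f0 (X i) + σ0 * mulVecF Sh g i) ∧
      r y = tmulVecF Γ g + δ := by
    let gy : (Fin n → ℝ) → (Fin n → ℝ) := fun y i =>
      σ0⁻¹ * (mulVecF R y i - mulVecF R (fun j => f0 (X j)) i)
    refine ⟨fun y => tmulVecF Γ (gy y) + δ, ?_, fun y => ⟨gy y, ?_, rfl⟩⟩
    · have h1 := hmul R
      have h2 : Measurable gy := by simp only [gy]; fun_prop
      exact ((htmul Γ).comp h2).add_const _
    · rw [hWh]
      ext i
      simp only [gy]
      field_simp
      ring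
  obtain ⟨r, hrm, hr⟩ := hr
  refine ⟨hfun (pDisc X Z T Γ b) (pD b S) hpD (measurable_pD b S hS)
      (disc_valid hb2 S hS δ hδ α0 hα0 ω hωδ v hv α) ⟨r, hrm, fun y => ?_⟩,
    hfun (pCont X Z T Γ b) _ hpC (measurable_pC b S hS)
      (cont_valid hb1 hb2 S hS δ hδ α0 hα0 ω hωδ v hv α) ⟨r, hrm, fun y => ?_⟩⟩
  · obtain ⟨g, h1, h2⟩ := hr y
    rw [h1, h2, hpD]
  · obtain ⟨g, h1, h2⟩ := hr y
    rw [h1, h2, hpC]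
end
end
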